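/- Let k be a field, let K = k(t) be the rational function field over k, let p ≥ 3 be a prime with p·(p−1) ≠ 0 in k, and let B ∈ k(t) be non-constant (B ∉ k), so that p·B^{p−1} + (p−1) ≠ 0. Define the trinomial φ_{p,B}(x) = x^p + ((−p·B^p − p·B)/(p·B^{p−1} + p − 1))·x^{p−1} + B over K, and for n ≥ 1 let K_n be a splitting field of φ_{p,B}^n over K. Then there exists a constant C ≥ 1 such that for all n ≥ 1, (p!)^{1 + p + p² + ⋯ + p^{n−1}} ≤ C · [K_n : K]. (This says that the image of the arboreal representation of φ_{p,B} has finite index in Aut(T_p): the order of the automorphism group of the depth-n regular p-ary rooted tree is (p!)^{1+p+⋯+p^{n−1}}, the Galois group Gal(K_n/K) embeds into this group, and finite index of the profinite limit is equivalent to boundedness of the level-n indices.) -/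

import Mathlib

open Polynomial

/-- The `n`-fold iterate `φ^n` of a polynomial under composition (`φ^0 = x`). -/
noncomputable def polyIter {R : Type*} [CommRing R] (φ : Polynomial R) : ℕ → Polynomial R
  | 0 => Polynomial.X
  | n + 1 => φ.comp (polyIter φ n)

lemma siegel_quadratic {R : Type*} [CommRing R] [IsDomain R]
    (T a1 b0 r P V W ω E F Θ G0 G1 H0 H1 Q : R)
    (hV : V ≠ 0) (hF : F ≠ 0)
    (h1 : T * W = T * P ^ 3 + 3 * a1 * P * V ^ 2 + b0 * V ^ 3)
    (hW : W = E * F)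
    (hQ : Q = ω * V * T - r * (T * P ^ 2 + 2 * a1 * V ^ 2))
    (hG1 : V * G1 = P * G0 + 2 * r * ω * W * T ^ 2)
    (hQ2 : Q ^ 2 = V * G0 + T ^ 2 * r ^ 2 * P * W)
    (hH0 : Θ * G0 = F * H0) (hH1 : Θ * G1 = F * H1) :
    (H0 ^ 2 - 4 * r ^ 2 * T ^ 2 * (Θ * E) * H1 + 4 * a1 * r ^ 4 * T ^ 3 * (Θ * E) ^ 2) * P ^ 2
    + (- 2 * H0 * H1 - 4 * a1 * r ^ 2 * T * (Θ * E) * H0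
        - 4 * b0 * r ^ 4 * T ^ 3 * (Θ * E) ^ 2) * (P * V)
    + (H1 ^ 2 - 8 * a1 * r ^ 2 * T * (Θ * E) * H1 - 4 * b0 * r ^ 2 * T * (Θ * E) * H0
        + 16 * a1 ^ 2 * r ^ 4 * T ^ 2 * (Θ * E) ^ 2) * V ^ 2 = 0 := by
  have e1 : 2 * r * T * W * Q = V * (V * G1 - P * G0)
      - 2 * r ^ 2 * T * W * (T * P ^ 2 + 2 * a1 * V ^ 2) := by
    linear_combination (2 * r * T * W) * hQ - V * hG1
  have e2 : (V * (V * G1 - P * G0) - 2 * r ^ 2 * T * W * (T * P ^ 2 + 2 * a1 * V ^ 2)) ^ 2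
      = 4 * r ^ 2 * T ^ 2 * W ^ 2 * (V * G0 + T ^ 2 * r ^ 2 * P * W) := by
    rw [← e1, ← hQ2]; ring
  have e3 : V ^ 2 * ((G0 ^ 2 - 4 * r ^ 2 * T ^ 2 * W * G1 + 4 * a1 * r ^ 4 * T ^ 3 * W ^ 2) * P ^ 2
    + (- 2 * G0 * G1 - 4 * a1 * r ^ 2 * T * W * G0
        - 4 * b0 * r ^ 4 * T ^ 3 * W ^ 2) * (P * V)
    + (G1 ^ 2 - 8 * a1 * r ^ 2 * T * W * G1 - 4 * b0 * r ^ 2 * T * W * G0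
        + 16 * a1 ^ 2 * r ^ 4 * T ^ 2 * W ^ 2) * V ^ 2) = 0 := by
    linear_combination e2 + (4 * r ^ 2 * T * W * V * G0 + 4 * r ^ 4 * T ^ 3 * W ^ 2 * P) * h1
  have e4 := (mul_eq_zero.1 e3).resolve_left (pow_ne_zero _ hV)
  have e5 : ((Θ * G0) ^ 2 - 4 * r ^ 2 * T ^ 2 * W * Θ * (Θ * G1)
      + 4 * a1 * r ^ 4 * T ^ 3 * W ^ 2 * Θ ^ 2) * P ^ 2
    + (- 2 * (Θ * G0) * (Θ * G1) - 4 * a1 * r ^ 2 * T * W * Θ * (Θ * G0)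
        - 4 * b0 * r ^ 4 * T ^ 3 * W ^ 2 * Θ ^ 2) * (P * V)
    + ((Θ * G1) ^ 2 - 8 * a1 * r ^ 2 * T * W * Θ * (Θ * G1) - 4 * b0 * r ^ 2 * T * W * Θ * (Θ * G0)
        + 16 * a1 ^ 2 * r ^ 4 * T ^ 2 * W ^ 2 * Θ ^ 2) * V ^ 2 = 0 := by
    linear_combination Θ ^ 2 * e4
  rw [hH0, hH1, hW] at e5
  have e6 := e5
  apply (mul_eq_zero.1 (?_ : F ^ 2 * _ = 0)).resolve_left (pow_ne_zero _ hF)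
  linear_combination e5

/-- A polynomial all of whose roots are multiple divides the square of its derivative. -/
lemma dvd_derivative_sq {k : Type*} [Field k] [IsAlgClosed k] (F : k[X]) (hF : F ≠ 0)
    (h : ∀ a, F.IsRoot a → 2 ≤ F.rootMultiplicity a) : F ∣ (derivative F) ^ 2 := by
  classical
  by_cases hd : derivative F = 0
  · simp [hd]
  rw [(IsAlgClosed.splits F).dvd_iff_roots_le_roots hF (pow_ne_zero _ hd)]
  rw [Multiset.le_iff_count]
  intro a
  rw [count_roots, count_roots]
  by_cases ha : F.IsRoot a
  · have h2 := h a ha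
    have : (X - C a) ^ (F.rootMultiplicity a - 1) ∣ derivative F :=
      Polynomial.pow_sub_one_dvd_derivative_of_pow_dvd (pow_rootMultiplicity_dvd F a)
    have h3 := pow_dvd_pow_of_dvd this 2
    rw [← pow_mul, ← le_rootMultiplicity_iff (pow_ne_zero _ hd)] at h3
    omega
  · rw [rootMultiplicity_eq_zero ha]; omega

lemma natDegree_sub_le_same {k : Type*} [Field k] {p q : k[X]} {n : ℕ} (hp : p.natDegree ≤ n)
    (hq : q.natDegree ≤ n) : (p - q).natDegree ≤ n :=
  (natDegree_sub_le p q).trans (max_le hp hq)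

set_option maxHeartbeats 1000000 in
/-- Abstract `p = 3` bound. -/
lemma siegel_bound {k : Type*} [Field k] (T a1 b0 r10 r : k[X])
    (hT : T ≠ 0) (hr : r ≠ 0) (h2 : (2 : k) ≠ 0)
    (hΔ : (27 : k[X]) * (4 * a1 ^ 3 + T * b0 ^ 2) ≠ 0)
    (hode1 : derivative a1 * T - a1 * derivative T = b0 * r + 2 * a1 * r10)
    (hode2 : T * (derivative b0 * T - b0 * derivative T) = 3 * T * b0 * r10 - 6 * a1 ^ 2 * r)
    (hnr : ∀ y z : k[X], z ≠ 0 → T * y ^ 3 + 3 * a1 * y * z ^ 2 + b0 * z ^ 3 ≠ 0) :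
    ∃ M : ℕ, ∀ P V W ω E F : k[X], V ≠ 0 → F ≠ 0 → E ≠ 0 → IsCoprime P V → IsCoprime W V →
      T * W = T * P ^ 3 + 3 * a1 * P * V ^ 2 + b0 * V ^ 3 →
      V * ω = T * (derivative P * V - P * derivative V) - r10 * P * V →
      W = E * F → F ∣ (derivative F) ^ 2 →
      V.natDegree ≤ P.natDegree → ω.natDegree ≤ P.natDegree + T.natDegree + r10.natDegree →
      W.natDegree = 3 * P.natDegree →
      P.natDegree ≤ 2 * E.natDegree + M := by
  set Δ : k[X] := 27 * (4 * a1 ^ 3 + T * b0 ^ 2) with hΔdef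
  set c : ℕ := T.natDegree + a1.natDegree + b0.natDegree + r10.natDegree + r.natDegree
    + Δ.natDegree with hc
  refine ⟨100 * c, ?_⟩
  intro P V W ω E F hV hF hE hPV hWV h1 hω hW hFF dV dω dW
  set d := P.natDegree with hd
  obtain ⟨Q, hQ⟩ : ∃ Q, Q = ω * V * T - r * (T * P ^ 2 + 2 * a1 * V ^ 2) := ⟨_, rfl⟩
  obtain ⟨G0, hG0⟩ : ∃ G0, G0 = ω ^ 2 * V * T ^ 2 - 2 * r * ω * T ^ 2 * P ^ 2
    - 4 * r * a1 * ω * T * V ^ 2 + r ^ 2 * a1 * T * P ^ 2 * V - r ^ 2 * b0 * T * P * V ^ 2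
    + 4 * r ^ 2 * a1 ^ 2 * V ^ 3 := ⟨_, rfl⟩
  obtain ⟨G1, hG1⟩ : ∃ G1, G1 = P * ω ^ 2 * T ^ 2 + 2 * a1 * r * ω * P * V * T
    + 2 * r * b0 * ω * V ^ 2 * T + r ^ 2 * a1 * T * P ^ 3 - r ^ 2 * b0 * T * P ^ 2 * V
    + 4 * r ^ 2 * a1 ^ 2 * P * V ^ 2 := ⟨_, rfl⟩
  have hQ2 : Q ^ 2 = V * G0 + T ^ 2 * r ^ 2 * P * W := by
    rw [hQ, hG0]; linear_combination (-T * r ^ 2 * P) * h1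
  have hG1' : V * G1 = P * G0 + 2 * r * ω * W * T ^ 2 := by
    rw [hG1, hG0]; linear_combination (-2 * r * ω * T) * h1
  have hder := congrArg derivative h1
  simp only [derivative_mul, derivative_add, derivative_pow, derivative_ofNat] at hder
  have hI : T ^ 3 * V * derivative W = (3 * T * P ^ 2 + 3 * a1 * V ^ 2) * Q
      + W * (3 * T ^ 2 * (r * P + r10 * V) + 3 * T ^ 3 * derivative V) := by
    rw [hQ]
    have hder' : derivative T * W + T * derivative W = derivative T * P ^ 3
      + T * (3 * P ^ 2 * derivative P) + 3 * derivative a1 * P * V ^ 2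
      + 3 * a1 * derivative P * V ^ 2 + 6 * a1 * P * V * derivative V
      + derivative b0 * V ^ 3 + 3 * b0 * V ^ 2 * derivative V := by
      have hC2 : (C ((2 : ℕ) : k)) = 2 := by simp only [map_natCast]; rfl
      have hC3 : (C ((3 : ℕ) : k)) = 3 := by simp only [map_natCast]; rfl
      rw [hder, hC2, hC3]; ring
    linear_combination (T ^ 2 * V) * hder' + (3 * T * P * V ^ 3) * hode1 + V ^ 4 * hode2
      - (3 * T * P ^ 2 + 3 * a1 * V ^ 2) * T * hω
      - (T * V * derivative T + 3 * T * (r * P + r10 * V) + 3 * T ^ 2 * derivative V) * h1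
  have hII : Δ * V ^ 4 = (18 * a1 * T * P ^ 2 - 9 * b0 * T * P * V + 36 * a1 ^ 2 * V ^ 2)
      * (3 * T * P ^ 2 + 3 * a1 * V ^ 2) - (54 * a1 * P - 27 * b0 * V) * T ^ 2 * W := by
    rw [hΔdef]; linear_combination ((54 * a1 * P - 27 * b0 * V) * T) * h1
  have hFW : F ∣ W := ⟨E, by rw [hW]; ring⟩
  have hFW2 : F ∣ (derivative W) ^ 2 := by
    obtain ⟨y, hy⟩ := hFF
    refine ⟨derivative E ^ 2 * F + 2 * derivative E * E * derivative F + E ^ 2 * y, ?_⟩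
    rw [hW, derivative_mul]; linear_combination E ^ 2 * hy
  have hFV : IsCoprime F V := IsCoprime.of_isCoprime_of_dvd_left hWV hFW
  have hFgQ : F ∣ ((3 * T * P ^ 2 + 3 * a1 * V ^ 2) * Q) ^ 2 := by
    obtain ⟨y, hy⟩ := hFW
    obtain ⟨z, hz⟩ := hFW2
    have : (3 * T * P ^ 2 + 3 * a1 * V ^ 2) * Q = T ^ 3 * V * derivative W
      - F * (y * (3 * T ^ 2 * (r * P + r10 * V) + 3 * T ^ 3 * derivative V)) := by
      rw [← mul_assoc, ← hy]; linear_combination -hI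
    rw [this]
    set q := y * (3 * T ^ 2 * (r * P + r10 * V) + 3 * T ^ 3 * derivative V)
    refine ⟨(T ^ 3 * V) ^ 2 * z - 2 * T ^ 3 * V * derivative W * q + F * q ^ 2, ?_⟩
    linear_combination (T ^ 3 * V) ^ 2 * hz
  have hFΔ : F ∣ Δ ^ 2 * Q ^ 2 := by
    have : F ∣ V ^ 8 * (Δ ^ 2 * Q ^ 2) := by
      obtain ⟨y, hy⟩ := hFW
      obtain ⟨z, hz⟩ := hFgQ
      set s := 18 * a1 * T * P ^ 2 - 9 * b0 * T * P * V + 36 * a1 ^ 2 * V ^ 2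
      set g := 3 * T * P ^ 2 + 3 * a1 * V ^ 2
      set q := (54 * a1 * P - 27 * b0 * V) * T ^ 2
      have e : V ^ 8 * (Δ ^ 2 * Q ^ 2) = (Δ * V ^ 4) ^ 2 * Q ^ 2 := by ring
      rw [e, hII, hy]
      refine ⟨s ^ 2 * z + Q ^ 2 * (- 2 * s * g * q * y + F * q ^ 2 * y ^ 2), ?_⟩
      linear_combination s ^ 2 * hz
    exact (hFV.pow_right).dvd_of_dvd_mul_left this
  have hFG0 : F ∣ Δ ^ 2 * G0 := by
    have : F ∣ V * (Δ ^ 2 * G0) := by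
      have e : V * (Δ ^ 2 * G0) = Δ ^ 2 * Q ^ 2 - W * (Δ ^ 2 * T ^ 2 * r ^ 2 * P) := by
        rw [hQ2]; ring
      rw [e]; exact dvd_sub hFΔ (hFW.mul_right _)
    exact hFV.dvd_of_dvd_mul_left this
  have hFG1 : F ∣ Δ ^ 2 * G1 := by
    have : F ∣ V * (Δ ^ 2 * G1) := by
      have e : V * (Δ ^ 2 * G1) = (Δ ^ 2 * G0) * P + W * (Δ ^ 2 * 2 * r * ω * T ^ 2) := by
        linear_combination Δ ^ 2 * hG1'
      rw [e]; exact dvd_add (hFG0.mul_right _) (hFW.mul_right _)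
    exact hFV.dvd_of_dvd_mul_left this
  obtain ⟨H0, hH0⟩ := hFG0
  obtain ⟨H1, hH1⟩ := hFG1
  have key := siegel_quadratic T a1 b0 r P V W ω E F (Δ ^ 2) G0 G1 H0 H1 Q hV hF h1 hW hQ hG1'
    hQ2 hH0 hH1
  have dP : P.natDegree ≤ d := le_rfl
  have dω' : ω.natDegree ≤ d + c := by omega
  have dT : T.natDegree ≤ c := by omega
  have da : a1.natDegree ≤ c := by omega
  have db : b0.natDegree ≤ c := by omega
  have dr : r.natDegree ≤ c := by omega
  have dΔ : Δ.natDegree ≤ c := by omega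
  have dE : E.natDegree ≤ E.natDegree := le_rfl
  have d2 : (2 : k[X]).natDegree ≤ 0 := (natDegree_ofNat 2).le
  have d4 : (4 : k[X]).natDegree ≤ 0 := (natDegree_ofNat 4).le
  have d8 : (8 : k[X]).natDegree ≤ 0 := (natDegree_ofNat 8).le
  have d16 : (16 : k[X]).natDegree ≤ 0 := (natDegree_ofNat 16).le
  have dG0 : G0.natDegree ≤ 3 * d + 10 * c := by
    rw [hG0]
    repeat' first
      | with_reducible apply natDegree_add_le_of_degree_le
      | with_reducible apply natDegree_sub_le_same
    all_goals
      eapply Nat.le_trans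
      ·
        repeat' first
          | with_reducible assumption
          | with_reducible apply natDegree_pow_le_of_le
          | with_reducible apply natDegree_mul_le_of_le
      · omega
  have dG1 : G1.natDegree ≤ 3 * d + 10 * c := by
    rw [hG1]
    repeat' first
      | with_reducible apply natDegree_add_le_of_degree_le
      | with_reducible apply natDegree_sub_le_same
    all_goals
      eapply Nat.le_trans
      ·
        repeat' first
          | with_reducible assumption
          | with_reducible apply natDegree_pow_le_of_le
          | with_reducible apply natDegree_mul_le_of_le
      · omega
  have hΔ0 : Δ ≠ 0 := hΔ
  have dEF : E.natDegree + F.natDegree = 3 * d := by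
    rw [← dW, hW, natDegree_mul hE hF]
  have dH : ∀ G H : k[X], G.natDegree ≤ 3 * d + 10 * c → Δ ^ 2 * G = F * H →
      H.natDegree ≤ E.natDegree + 12 * c := by
    intro G H hG hH
    by_cases hH0 : H = 0
    · simp [hH0]
    have := congrArg natDegree hH
    rw [natDegree_mul hF hH0] at this
    have h3 : (Δ ^ 2 * G).natDegree ≤ 2 * c + (3 * d + 10 * c) :=
      natDegree_mul_le_of_le (natDegree_pow_le_of_le 2 dΔ) hG
    omega
  have dH0 := dH _ _ dG0 hH0
  have dH1 := dH _ _ dG1 hH1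
  set e := E.natDegree with he
  set c2 := H0 ^ 2 - 4 * r ^ 2 * T ^ 2 * (Δ ^ 2 * E) * H1
    + 4 * a1 * r ^ 4 * T ^ 3 * (Δ ^ 2 * E) ^ 2 with hc2
  set c1 := - 2 * H0 * H1 - 4 * a1 * r ^ 2 * T * (Δ ^ 2 * E) * H0
        - 4 * b0 * r ^ 4 * T ^ 3 * (Δ ^ 2 * E) ^ 2 with hc1
  set c0 := H1 ^ 2 - 8 * a1 * r ^ 2 * T * (Δ ^ 2 * E) * H1 - 4 * b0 * r ^ 2 * T * (Δ ^ 2 * E) * H0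
        + 16 * a1 ^ 2 * r ^ 4 * T ^ 2 * (Δ ^ 2 * E) ^ 2 with hc0
  have dm2 : (-2 : k[X]).natDegree ≤ 0 := by rw [natDegree_neg]; exact d2
  have dc1 : c1.natDegree ≤ 2 * e + 100 * c := by
    rw [hc1]
    repeat' first
      | with_reducible apply natDegree_add_le_of_degree_le
      | with_reducible apply natDegree_sub_le_same
    all_goals
      eapply Nat.le_trans
      ·
        repeat' first
          | with_reducible assumption
          | with_reducible apply natDegree_pow_le_of_le
          | with_reducible apply natDegree_mul_le_of_le
      · omega
  have dc0 : c0.natDegree ≤ 2 * e + 100 * c := by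
    rw [hc0]
    repeat' first
      | with_reducible apply natDegree_add_le_of_degree_le
      | with_reducible apply natDegree_sub_le_same
    all_goals
      eapply Nat.le_trans
      ·
        repeat' first
          | with_reducible assumption
          | with_reducible apply natDegree_pow_le_of_le
          | with_reducible apply natDegree_mul_le_of_le
      · omega
  by_cases hP : P = 0
  · have : d = 0 := by rw [hd, hP]; simp
    omega
  by_cases h0 : c0 = 0
  · have key2 : c2 * P + c1 * V = 0 := by
      have : P * (c2 * P + c1 * V) = 0 := by rw [h0] at key; linear_combination key
      exact (mul_eq_zero.1 this).resolve_left hP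
    by_cases h1' : c1 = 0
    · exfalso
      have hc20 : c2 = 0 := by
        rw [h1', zero_mul, add_zero] at key2
        exact (mul_eq_zero.1 key2).resolve_right hP
      apply hnr H0 (2 * r ^ 2 * T ^ 2 * (Δ ^ 2 * E))
      · have : (2 : k[X]) ≠ 0 := by
          have := (C_ne_zero (R := k)).2 h2
          rwa [map_ofNat] at this
        exact mul_ne_zero (mul_ne_zero (mul_ne_zero this (pow_ne_zero _ hr)) (pow_ne_zero _ hT))
          (mul_ne_zero (pow_ne_zero _ hΔ0) hE)
      · rw [hc1] at h1'
        rw [hc2] at hc20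
        linear_combination (-2 * r ^ 2 * T ^ 3 * (Δ ^ 2 * E)) * h1' + T * H0 * hc20
    · have : P ∣ c1 := by
        apply hPV.dvd_of_dvd_mul_right
        exact ⟨-c2, by linear_combination key2⟩
      exact (natDegree_le_of_dvd this h1').trans dc1
  · have : P ∣ c0 := by
      apply (hPV.pow_right (n := 2)).dvd_of_dvd_mul_right
      exact ⟨-c2 * P - c1 * V, by linear_combination key⟩
    exact (natDegree_le_of_dvd this h0).trans dc0

/-- A group of permutations, transitive and compatible with a partition into blocks of prime size,
that contains a transposition, contains all permutations preserving every block. -/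
lemma perm_mem_of_swap {R Q : Type*} [Fintype R] [DecidableEq R] [DecidableEq Q] (π : R → Q)
    (p : ℕ) (hp : p.Prime)
    (hfib : ∀ a : R, (Finset.univ.filter (fun b => π b = π a)).card = p)
    (G : Subgroup (Equiv.Perm R)) (htrans : ∀ a b, ∃ g ∈ G, g a = b)
    (hcompat : ∀ g ∈ G, ∀ a b, π a = π b → π (g a) = π (g b))
    (b1 b2 : R) (hb : b1 ≠ b2) (hswap : Equiv.swap b1 b2 ∈ G)
    (τ : Equiv.Perm R) (hτ : ∀ a, π (τ a) = π a) : τ ∈ G := by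
  classical
  have hpi : ∀ a b, Equiv.swap a b ∈ G → π a = π b := by
    intro a b h
    by_contra hab
    have h2 : 1 < (Finset.univ.filter (fun b => π b = π a)).card := by
      rw [hfib]; exact hp.one_lt
    obtain ⟨c, hc, hca⟩ := Finset.exists_mem_ne h2 a
    rw [Finset.mem_filter] at hc
    have hcb : c ≠ b := by rintro rfl; exact hab hc.2.symm
    have := hcompat _ h c a hc.2
    rw [Equiv.swap_apply_of_ne_of_ne hca hcb, Equiv.swap_apply_left] at this
    exact hab (hc.2.symm.trans this)
  have hsymm : ∀ a b, Equiv.swap a b ∈ G → Equiv.swap b a ∈ G := by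
    intro a b h; rwa [Equiv.swap_comm]
  have htr : ∀ a b c, Equiv.swap a b ∈ G → Equiv.swap b c ∈ G → Equiv.swap a c ∈ G := by
    intro a b c h1 h2
    by_cases hab : a = b
    · rwa [hab]
    by_cases hac : a = c
    · rw [hac, Equiv.swap_self]; exact G.one_mem
    rw [Equiv.swap_comm, ← Equiv.swap_mul_swap_mul_swap hab hac]
    exact G.mul_mem (G.mul_mem h2 h1) h2
  let cl : R → Finset R := fun a => Finset.univ.filter (fun b => Equiv.swap a b ∈ G)
  have hcl : ∀ a b, b ∈ cl a ↔ Equiv.swap a b ∈ G := by intro a b; simp [cl]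
  have hconj : ∀ g ∈ G, ∀ a b, Equiv.swap a b ∈ G → Equiv.swap (g a) (g b) ∈ G := by
    intro g hg a b h
    rw [Equiv.swap_apply_apply]
    exact G.mul_mem (G.mul_mem hg h) (G.inv_mem hg)
  have hle : ∀ a b, (cl a).card ≤ (cl b).card := by
    intro a b
    obtain ⟨g, hg, rfl⟩ := htrans a b
    apply Finset.card_le_card_of_injOn g
    · intro x hx
      have := (hcl a x).1 hx
      exact (hcl _ _).2 (hconj g hg a x this)
    · exact g.injective.injOn
  have hcleq : ∀ a b, cl a = cl b ↔ Equiv.swap a b ∈ G := by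
    intro a b
    constructor
    · intro h
      rw [← hcl, h, hcl, Equiv.swap_self]; exact G.one_mem
    · intro h
      ext c
      rw [hcl, hcl]
      exact ⟨fun h' => htr _ _ _ (hsymm _ _ h) h', fun h' => htr _ _ _ h h'⟩
  have hsub : ∀ a, cl a ⊆ Finset.univ.filter (fun b => π b = π a) := by
    intro a x hx
    rw [Finset.mem_filter]
    exact ⟨Finset.mem_univ _, (hpi _ _ ((hcl _ _).1 hx)).symm⟩
  have hdvd : ∀ a, (cl a).card = p := by
    intro a
    have h1 := Finset.card_eq_sum_card_image cl (Finset.univ.filter (fun b => π b = π a))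
    rw [Finset.sum_const_nat (m := (cl a).card), hfib] at h1
    · have h2 : (cl a).card ∣ p := ⟨_, by rw [h1]; ring⟩
      rcases (Nat.dvd_prime hp).1 h2 with h3 | h3
      · exfalso
        have h4 : 1 < (cl b1).card := by
          rw [Finset.one_lt_card]
          refine ⟨b1, ?_, b2, ?_, hb⟩
          · rw [hcl, Equiv.swap_self]; exact G.one_mem
          · rw [hcl]; exact hswap
        have := hle b1 a
        omega
      · exact h3
    · intro x hx
      rw [Finset.mem_image] at hx
      obtain ⟨y, hy, rfl⟩ := hx
      rw [Finset.mem_filter] at hy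
      have : (Finset.univ.filter (fun b => π b = π a)).filter (fun z => cl z = cl y) = cl y := by
        ext z
        rw [Finset.mem_filter, hcleq, hcl, Finset.mem_filter]
        constructor
        · intro h; exact hsymm _ _ h.2
        · intro h
          exact ⟨⟨Finset.mem_univ _, (hpi _ _ h).symm.trans hy.2⟩, hsymm _ _ h⟩
      rw [this]
      exact le_antisymm (hle _ _) (hle _ _)
  have hall : ∀ a b, π a = π b → Equiv.swap a b ∈ G := by
    intro a b h
    rw [← hcl, Finset.eq_of_subset_of_card_le (hsub a) (by rw [hfib, hdvd]), Finset.mem_filter]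
    exact ⟨Finset.mem_univ _, h.symm⟩
  induction hn : τ.support.card using Nat.strong_induction_on generalizing τ with
  | _ n ih =>
    by_cases h1 : τ = 1
    · rw [h1]; exact G.one_mem
    obtain ⟨a, ha⟩ : ∃ a, τ a ≠ a := by
      by_contra hcon
      push Not at hcon
      exact h1 (Equiv.ext hcon)
    have hlt := Equiv.Perm.card_support_swap_mul ha
    have hsw := hall a (τ a) (hτ a).symm
    have := ih _ (hn ▸ hlt) (Equiv.swap a (τ a) * τ) ?_ rfl
    · have h2 := G.mul_mem hsw this
      rwa [← mul_assoc, Equiv.swap_mul_self, one_mul] at h2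
    · intro b
      rw [Equiv.Perm.mul_apply]
      by_cases h : τ b = a
      · rw [h, Equiv.swap_apply_left, hτ, ← h, hτ]
      · by_cases h3 : τ b = τ a
        · rw [h3, Equiv.swap_apply_right, ← hτ a, ← h3, hτ]
        · rw [Equiv.swap_apply_of_ne_of_ne h h3, hτ]

lemma galois_step {K : Type*} [Field K] (f φ : K[X]) (p : ℕ) (hp : p.Prime)
    (hφ : φ.natDegree = p) (hirr : Irreducible (f.comp φ)) (hsep : (f.comp φ).Separable)
    (E : Type*) [Field E] [Algebra K E] [(f.comp φ).IsSplittingField K E]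
    (σ : E ≃ₐ[K] E) (z1 z2 : E) (hz : z1 ≠ z2)
    (hz1 : aeval z1 (f.comp φ) = 0) (hz2 : aeval z2 (f.comp φ) = 0)
    (hσ1 : σ z1 = z2) (hσ2 : σ z2 = z1)
    (hσ : ∀ z, aeval z (f.comp φ) = 0 → z ≠ z1 → z ≠ z2 → σ z = z) :
    p.factorial ^ f.natDegree * Module.finrank K f.SplittingField ≤
      Module.finrank K E := by
  classical
  have hfd : FiniteDimensional K E := IsSplittingField.finiteDimensional E (f.comp φ)
  have hg0 : f.comp φ ≠ 0 := hirr.ne_zero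
  have hf0 : f ≠ 0 := by rintro rfl; simp at hg0
  have hφ0 : φ ≠ 0 := by rintro rfl; simp at hφ; exact hp.ne_zero hφ.symm
  have : IsGalois K E := IsGalois.of_separable_splitting_field (p := f.comp φ) hsep
  let Rt := (f.comp φ).rootSet E
  let Qt := f.rootSet E
  have hR : ∀ z : E, z ∈ Rt ↔ aeval z (f.comp φ) = 0 := fun z => by
    rw [mem_rootSet]; exact ⟨fun h => h.2, fun h => ⟨hg0, h⟩⟩
  have hQ : ∀ z : E, z ∈ Qt ↔ aeval z f = 0 := fun z => by
    rw [mem_rootSet]; exact ⟨fun h => h.2, fun h => ⟨hf0, h⟩⟩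
  have hpiR : ∀ z : E, z ∈ Rt → aeval z φ ∈ Qt := by
    intro z h
    rw [hR, aeval_comp] at h
    rw [hQ]; exact h
  let π : Rt → Qt := fun z => ⟨aeval z.1 φ, hpiR _ z.2⟩
  have cR : Fintype.card Rt = f.natDegree * p := by
    rw [card_rootSet_eq_natDegree hsep (IsSplittingField.splits _ _), natDegree_comp, hφ]
  have hQr : Fintype.card Qt ≤ (f.aroots E).card := by
    have h1 : Fintype.card Qt = (f.aroots E).toFinset.card := by
      rw [← Nat.card_eq_fintype_card, Nat.card_coe_set_eq, ← Set.ncard_coe_finset]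
      congr 1
    rw [h1]
    exact Multiset.toFinset_card_le _
  have cQ : Fintype.card Qt ≤ f.natDegree := by
    exact hQr.trans ((card_roots' _).trans (natDegree_map_le))
  have cfib : ∀ q : Qt, (Finset.univ.filter (fun b => π b = q)).card ≤ p := by
    intro q
    have hne : φ.map (algebraMap K E) - C q.1 ≠ 0 := by
      intro h0
      have : (φ.map (algebraMap K E)).natDegree = 0 := by
        rw [sub_eq_zero.1 h0, natDegree_C]
      rw [natDegree_map, hφ] at this
      exact hp.ne_zero this
    calc (Finset.univ.filter (fun b => π b = q)).card
        ≤ (φ.map (algebraMap K E) - C q.1).roots.toFinset.card := by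
          apply Finset.card_le_card_of_injOn (fun b => b.1)
          · intro b hb
            have hb' : π b = q := by simpa using hb
            simp only [Finset.mem_coe, Multiset.mem_toFinset]
            rw [mem_roots hne, IsRoot, eval_sub, eval_C, eval_map, ← hb', ← aeval_def]
            simp [π]
          · exact Subtype.val_injective.injOn
      _ ≤ _ := (Multiset.toFinset_card_le _)
      _ ≤ _ := card_roots' _
      _ ≤ p := by rw [natDegree_sub_C, natDegree_map, hφ]
  have hsum : (Finset.univ : Finset Rt).card =
      ∑ q : Qt, (Finset.univ.filter (fun b => π b = q)).card :=
    Finset.card_eq_sum_card_fiberwise (fun _ _ => Finset.mem_coe.2 (Finset.mem_univ _))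
  have hsum2 : ∑ q : Qt, (Finset.univ.filter (fun b => π b = q)).card ≤ ∑ q : Qt, p :=
    Finset.sum_le_sum (fun q _ => cfib q)
  have hsum3 : ∑ q : Qt, p = Fintype.card Qt * p := by simp
  have hpp : 0 < p := hp.pos
  have hcQ : Fintype.card Qt = f.natDegree := by
    apply le_antisymm cQ
    have : f.natDegree * p ≤ Fintype.card Qt * p := by
      rw [← cR, ← hsum3, ← Finset.card_univ, hsum]; exact hsum2
    exact Nat.le_of_mul_le_mul_right this hpp
  have hfibq : ∀ q : Qt, (Finset.univ.filter (fun b => π b = q)).card = p := by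
    have : ∑ q : Qt, (Finset.univ.filter (fun b => π b = q)).card = ∑ q : Qt, p := by
      rw [hsum3, hcQ, ← cR, ← Finset.card_univ, hsum]
    intro q
    exact (Finset.sum_eq_sum_iff_of_le (fun q _ => cfib q)).1 this q (Finset.mem_univ _)
  have hroot : ∀ (g : E ≃ₐ[K] E) (z : E), z ∈ Rt → g z ∈ Rt := by
    intro g z h
    rw [hR] at h ⊢
    rw [← AlgEquiv.coe_toAlgHom, aeval_algHom_apply, h, map_zero]
  let ρ : (E ≃ₐ[K] E) →* Equiv.Perm Rt :=
    { toFun := fun g =>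
        { toFun := fun z => ⟨g z.1, hroot g _ z.2⟩
          invFun := fun z => ⟨g⁻¹ z.1, hroot g⁻¹ _ z.2⟩
          left_inv := fun z => Subtype.ext (g.symm_apply_apply z.1)
          right_inv := fun z => Subtype.ext (g.apply_symm_apply z.1) }
      map_one' := rfl
      map_mul' := fun _ _ => rfl }
  have hρ : ∀ g z, ((ρ g z : Rt) : E) = g z.1 := fun _ _ => rfl
  have hτmem : ∀ τ : Equiv.Perm Rt, (∀ a, π (τ a) = π a) → τ ∈ ρ.range := by
    refine fun τ hτ => perm_mem_of_swap π p hp (fun a => hfibq _) ρ.range ?_ ?_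
      ⟨z1, (hR _).2 hz1⟩ ⟨z2, (hR _).2 hz2⟩ (fun h => hz (congrArg Subtype.val h)) ?_ τ hτ
    · intro a b
      have ha := (hR _).1 a.2
      have hb := (hR _).1 b.2
      have hm : minpoly K a.1 = minpoly K b.1 := by
        rw [← minpoly.eq_of_irreducible hirr ha, ← minpoly.eq_of_irreducible hirr hb]
      obtain ⟨g, hg⟩ := (Normal.minpoly_eq_iff_mem_orbit E (F := K)).1 hm.symm
      exact ⟨ρ g, ⟨g, rfl⟩, Subtype.ext hg⟩
    · rintro _ ⟨g, rfl⟩ a b hab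
      apply Subtype.ext
      have : aeval a.1 φ = aeval b.1 φ := congrArg Subtype.val hab
      change aeval (g a.1) φ = aeval (g b.1) φ
      rw [← AlgEquiv.coe_toAlgHom, aeval_algHom_apply, aeval_algHom_apply, this]
    · refine ⟨σ, ?_⟩
      ext a
      rw [hρ]
      by_cases h1 : a = ⟨z1, (hR _).2 hz1⟩
      · rw [h1, Equiv.swap_apply_left]; exact hσ1
      by_cases h2 : a = ⟨z2, (hR _).2 hz2⟩
      · rw [h2, Equiv.swap_apply_right]; exact hσ2
      rw [Equiv.swap_apply_of_ne_of_ne h1 h2]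
      exact hσ _ ((hR _).1 a.2) (fun h => h1 (Subtype.ext h)) (fun h => h2 (Subtype.ext h))
  let L : IntermediateField K E := IntermediateField.adjoin K Qt
  have hspl : (f.map (algebraMap K E)).Splits := by
    rw [splits_iff_card_roots]
    apply le_antisymm (card_roots' _)
    rw [natDegree_map, ← hcQ]
    exact hQr
  have : f.IsSplittingField K L := IntermediateField.adjoin_rootSet_isSplittingField hspl
  have hL : Module.finrank K f.SplittingField = Module.finrank K L :=
    (LinearEquiv.finrank_eq (IsSplittingField.algEquiv L f).toLinearEquiv).symm
  have hfix : Nat.card L.fixingSubgroup = Module.finrank L E :=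
    IsGalois.card_fixingSubgroup_eq_finrank L
  have hcard : p.factorial ^ f.natDegree ≤ Nat.card L.fixingSubgroup := by
    have h1 := DomMulAct.stabilizer_card π
    have h2 : ∏ i, (Fintype.card {a // π a = i}).factorial = p.factorial ^ f.natDegree := by
      rw [← hcQ, ← Finset.card_univ, ← Finset.prod_const]
      refine Finset.prod_congr rfl fun q _ => ?_
      rw [Fintype.card_subtype, hfibq]
    rw [← h2, ← h1, ← Nat.card_eq_fintype_card]
    have hex : ∀ τ : {g : Equiv.Perm Rt // π ∘ g = π}, ∃ g : L.fixingSubgroup, ρ g = τ.1 := by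
      rintro ⟨τ, hτ⟩
      obtain ⟨g, hg⟩ := hτmem τ (fun a => congrFun hτ a)
      refine ⟨⟨g, ?_⟩, hg⟩
      rw [IntermediateField.mem_fixingSubgroup_iff]
      have hle : L ≤ IntermediateField.fixedField (Subgroup.zpowers g) := by
        rw [IntermediateField.adjoin_le_iff]
        intro q hq
        obtain ⟨r, hr⟩ : ∃ r, π r = ⟨q, hq⟩ := by
          have : 0 < (Finset.univ.filter (fun b => π b = ⟨q, hq⟩)).card := by
            rw [hfibq]; exact hpp
          obtain ⟨r, hr⟩ := Finset.card_pos.1 this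
          exact ⟨r, (Finset.mem_filter.1 hr).2⟩
        have hgq : g q = q := by
          have e1 : π (ρ g r) = π r := by rw [hg]; exact congrFun hτ r
          have e2 : aeval (g r.1) φ = aeval r.1 φ := congrArg Subtype.val e1
          have e3 : aeval r.1 φ = q := congrArg Subtype.val hr
          rw [← AlgEquiv.coe_toAlgHom, aeval_algHom_apply, e3] at e2
          exact e2
        change q ∈ IntermediateField.fixedField (Subgroup.zpowers g)
        rw [IntermediateField.mem_fixedField_iff]
        intro h hh
        have hst : Subgroup.zpowers g ≤ MulAction.stabilizer (E ≃ₐ[K] E) q := by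
          rw [Subgroup.zpowers_le]; exact hgq
        exact hst hh
      intro x hx
      exact (IntermediateField.mem_fixedField_iff _ x).1 (hle hx) g (Subgroup.mem_zpowers g)
    choose F hF using hex
    apply Nat.card_le_card_of_injective F
    intro a b hab
    apply Subtype.ext
    rw [← hF, ← hF, hab]
  calc _ = p.factorial ^ f.natDegree * Module.finrank K L := by rw [hL]
    _ ≤ Module.finrank L E * Module.finrank K L := by
      rw [← hfix]; exact Nat.mul_le_mul_right _ hcard
    _ = _ := by rw [mul_comm]; exact Module.finrank_mul_finrank K L E

lemma swap_step {K : Type*} [Field K] (f φ : K[X]) (p : ℕ) (hp : p.Prime)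
    (hφ : φ.natDegree = p) (hirr : Irreducible (f.comp φ)) (hsep : (f.comp φ).Separable)
    (M : Type*) [Field M] [Algebra K M] (σ : M ≃ₐ[K] M) (S : Finset M)
    (hScard : (f.comp φ).natDegree ≤ S.card) (hS : ∀ z ∈ S, aeval z (f.comp φ) = 0)
    (z1 z2 : M) (hz : z1 ≠ z2) (hz1 : z1 ∈ S) (hz2 : z2 ∈ S) (hσ1 : σ z1 = z2) (hσ2 : σ z2 = z1)
    (hσ : ∀ z ∈ S, z ≠ z1 → z ≠ z2 → σ z = z) :
    p.factorial ^ f.natDegree * Module.finrank K f.SplittingField ≤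
      Module.finrank K (f.comp φ).SplittingField := by
  classical
  set g := f.comp φ with hg
  have hg0 : g ≠ 0 := hirr.ne_zero
  have hgm : g.map (algebraMap K M) ≠ 0 := map_ne_zero hg0
  have hSsub : S.val ≤ (g.map (algebraMap K M)).roots := by
    rw [Multiset.le_iff_subset S.nodup]
    intro z hzS
    rw [mem_roots hgm, IsRoot, eval_map, ← aeval_def]
    exact hS z hzS
  have hroots : S.val = (g.map (algebraMap K M)).roots := by
    apply Multiset.eq_of_le_of_card_le hSsub
    refine (card_roots' _).trans ?_
    rw [natDegree_map]; exact hScard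
  have hspl : (g.map (algebraMap K M)).Splits := by
    rw [splits_iff_card_roots]
    apply le_antisymm (card_roots' _)
    rw [natDegree_map, ← hroots]; exact hScard
  have hmemS : ∀ z : M, aeval z g = 0 → z ∈ S := by
    intro z h
    have : z ∈ (g.map (algebraMap K M)).roots := by
      rw [mem_roots hgm, IsRoot, eval_map, ← aeval_def]; exact h
    rw [← hroots] at this
    exact this
  let E := IntermediateField.adjoin K (g.rootSet M)
  have hsp : g.IsSplittingField K E := IntermediateField.adjoin_rootSet_isSplittingField hspl
  have hn : Normal K E := Normal.of_isSplittingField g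
  have hmemE : ∀ z ∈ S, z ∈ E := by
    intro z h
    apply IntermediateField.subset_adjoin
    rw [mem_rootSet]
    exact ⟨hg0, hS z h⟩
  have hfin : Module.finrank K g.SplittingField = Module.finrank K E :=
    (LinearEquiv.finrank_eq (IsSplittingField.algEquiv E g).toLinearEquiv).symm
  rw [hfin]
  have hres : ∀ x : E, ((σ.restrictNormal E x : E) : M) = σ (x : M) := fun x =>
    σ.restrictNormal_commutes E x
  have hae : ∀ x : E, aeval (x : M) g = ((aeval x g : E) : M) := fun x =>
    aeval_algebraMap_apply M x g
  refine galois_step f φ p hp hφ hirr hsep E (σ.restrictNormal E) ⟨z1, hmemE _ hz1⟩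
    ⟨z2, hmemE _ hz2⟩ (fun h => hz (congrArg Subtype.val h)) ?_ ?_ ?_ ?_ ?_
  · apply Subtype.ext; rw [← hg, ← hae]; exact hS _ hz1
  · apply Subtype.ext; rw [← hg, ← hae]; exact hS _ hz2
  · apply Subtype.ext; rw [hres]; exact hσ1
  · apply Subtype.ext; rw [hres]; exact hσ2
  · intro z h0 h1 h2
    apply Subtype.ext
    rw [hres]
    apply hσ
    · apply hmemS
      rw [hae]; rw [← hg] at h0; rw [h0]; rfl
    · intro h; exact h1 (Subtype.ext h)
    · intro h; exact h2 (Subtype.ext h)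

/-- Hensel lifting without a monicity assumption. -/
lemma hensel_nonmonic (R : Type*) [CommRing R] (I : Ideal R) [IsAdicComplete I R]
    (f : R[X]) (a₀ : R) (h₁ : f.eval a₀ ∈ I)
    (h₂ : IsUnit (Ideal.Quotient.mk I (f.derivative.eval a₀))) :
    ∃ a, f.IsRoot a ∧ a - a₀ ∈ I := by
  classical
    let f' := derivative f
    let c : ℕ → R := fun n => Nat.recOn n a₀ fun _ b => b - f.eval b * Ring.inverse (f'.eval b)
    have hc : ∀ n, c (n + 1) = c n - f.eval (c n) * Ring.inverse (f'.eval (c n)) := by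
      intro n
      simp only [c]
    have hc_mod : ∀ n, c n ≡ a₀ [SMOD I] := by
      intro n
      induction n with
      | zero => rfl
      | succ n ih => ?_
      rw [hc, sub_eq_add_neg, ← add_zero a₀]
      refine ih.add ?_
      rw [SModEq.zero, Ideal.neg_mem_iff]
      refine I.mul_mem_right _ ?_
      rw [← SModEq.zero] at h₁ ⊢
      exact (ih.eval f).trans h₁
    have hf'c : ∀ n, IsUnit (f'.eval (c n)) := by
      intro n
      have := isLocalHom_of_le_jacobson_bot I (IsAdicComplete.le_jacobson_bot I)
      apply IsUnit.of_map (Ideal.Quotient.mk I)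
      convert! h₂ using 1
      exact SModEq.def.mp ((hc_mod n).eval _)
    have hfcI : ∀ n, f.eval (c n) ∈ I ^ (n + 1) := by
      intro n
      induction n with
      | zero => simpa only [Nat.rec_zero, zero_add, pow_one] using! h₁
      | succ n ih => ?_
      rw [← taylor_eval_sub (c n), hc, sub_eq_add_neg, sub_eq_add_neg,
        add_neg_cancel_comm]
      rw [eval_eq_sum, sum_over_range' _ _ _ (lt_add_of_pos_right _ zero_lt_two), ←
        Finset.sum_range_add_sum_Ico _ (Nat.le_add_left _ _)]
      swap
      · intro i
        rw [zero_mul]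
      refine Ideal.add_mem _ ?_ ?_
      · rw [← one_add_one_eq_two, Finset.sum_range_succ, Finset.range_one, Finset.sum_singleton,
          taylor_coeff_zero, taylor_coeff_one, pow_zero, pow_one, mul_one, mul_neg,
          mul_left_comm, Ring.mul_inverse_cancel _ (hf'c n), mul_one, add_neg_cancel]
        exact Ideal.zero_mem _
      · refine Submodule.sum_mem _ ?_
        simp only [Finset.mem_Ico]
        rintro i ⟨h2i, _⟩
        have aux : n + 2 ≤ i * (n + 1) := by trans 2 * (n + 1) <;> nlinarith only [h2i]
        refine Ideal.mul_mem_left _ _ (Ideal.pow_le_pow_right aux ?_)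
        rw [pow_mul']
        exact Ideal.pow_mem_pow ((Ideal.neg_mem_iff _).2 <| Ideal.mul_mem_right _ _ ih) _
    have aux : ∀ m n, m ≤ n → c m ≡ c n [SMOD (I ^ m • ⊤ : Ideal R)] := by
      intro m n hmn
      rw [← Ideal.one_eq_top, Ideal.smul_eq_mul, mul_one]
      obtain ⟨k, rfl⟩ := Nat.exists_eq_add_of_le hmn
      clear hmn
      induction k with
      | zero => rw [add_zero]
      | succ k ih => ?_
      rw [← add_assoc, hc, ← add_zero (c m), sub_eq_add_neg]
      refine ih.add ?_
      symm
      rw [SModEq.zero, Ideal.neg_mem_iff]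
      refine Ideal.mul_mem_right _ _ (Ideal.pow_le_pow_right ?_ (hfcI _))
      rw [add_assoc]
      exact le_self_add
    obtain ⟨a, ha⟩ := IsPrecomplete.prec' c (aux _ _)
    refine ⟨a, ?_, ?_⟩
    · show f.IsRoot a
      suffices ∀ n, f.eval a ≡ 0 [SMOD (I ^ n • ⊤ : Ideal R)] by exact IsHausdorff.haus' _ this
      intro n
      specialize ha n
      rw [← Ideal.one_eq_top, Ideal.smul_eq_mul, mul_one] at ha ⊢
      refine (ha.symm.eval f).trans ?_
      rw [SModEq.zero]
      exact Ideal.pow_le_pow_right le_self_add (hfcI _)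
    · show a - a₀ ∈ I
      specialize ha (0 + 1)
      rw [hc, pow_one, ← Ideal.one_eq_top, Ideal.smul_eq_mul, mul_one, sub_eq_add_neg] at ha
      rw [← SModEq.sub_mem, ← add_zero a₀]
      refine ha.symm.trans (SModEq.rfl.add ?_)
      rw [SModEq.zero, Ideal.neg_mem_iff]
      exact Ideal.mul_mem_right _ _ h₁

lemma ps_hensel {k : Type*} [Field k] (f : (PowerSeries k)[X]) (a0 : k)
    (h1 : PowerSeries.constantCoeff (f.eval (PowerSeries.C a0)) = 0)
    (h2 : PowerSeries.constantCoeff (f.derivative.eval (PowerSeries.C a0)) ≠ 0) :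
    ∃ a, f.eval a = 0 ∧ PowerSeries.constantCoeff a = a0 := by
  have q1 : f.eval (PowerSeries.C a0) ∈ Ideal.span {(PowerSeries.X : PowerSeries k)} := by
    rw [Ideal.mem_span_singleton, PowerSeries.X_dvd_iff]; exact h1
  have q2 : IsUnit (f.derivative.eval (PowerSeries.C a0)) := by
    rw [PowerSeries.isUnit_iff_constantCoeff]
    exact isUnit_iff_ne_zero.2 h2
  obtain ⟨a, ha, ha'⟩ := hensel_nonmonic (PowerSeries k) (Ideal.span {PowerSeries.X}) f
    (PowerSeries.C a0) q1 (q2.map _)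
  refine ⟨a, ha, ?_⟩
  rw [Ideal.mem_span_singleton, PowerSeries.X_dvd_iff, map_sub, PowerSeries.constantCoeff_C,
    sub_eq_zero] at ha'
  exact ha'

section local_swap
open PowerSeries (rescale)

lemma rescale_neg_one_twice {k : Type*} [Field k] (z : PowerSeries k) :
    rescale (-1 : k) (rescale (-1 : k) z) = z := by
  ext n
  rw [PowerSeries.coeff_rescale, PowerSeries.coeff_rescale, ← mul_assoc, ← mul_pow]
  simp

lemma even_coeff_one {k : Type*} [Field k] (h2 : (2 : k) ≠ 0) (z : PowerSeries k)
    (hz : rescale (-1 : k) z = z) : PowerSeries.coeff 1 z = 0 := by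
  have := congrArg (PowerSeries.coeff 1) hz
  rw [PowerSeries.coeff_rescale] at this
  have h : (2 : k) * PowerSeries.coeff 1 z = 0 := by linear_combination -this
  exact (mul_eq_zero.1 h).resolve_left h2

lemma even_dvd {k : Type*} [Field k] (h2 : (2 : k) ≠ 0) (z : PowerSeries k)
    (hz : rescale (-1 : k) z = z) (h0 : PowerSeries.constantCoeff z = 0) :
    ∃ y, z = PowerSeries.X ^ 2 * y := by
  have : (PowerSeries.X ^ 2 : PowerSeries k) ∣ z := by
    rw [PowerSeries.X_pow_dvd_iff]
    intro m hm
    interval_cases m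
    · rwa [PowerSeries.coeff_zero_eq_constantCoeff_apply]
    · exact even_coeff_one h2 z hz
  exact this

lemma local_swap {k : Type*} [Field k] [IsAlgClosed k] (h2 : (2 : k) ≠ 0)
    (g : (PowerSeries k)[X]) (hg : g.Monic)
    (hσ : g.map (rescale (-1 : k)) = g) (c : k)
    (hmult : (g.map (PowerSeries.constantCoeff (R := k))).rootMultiplicity c = 2)
    (hsimple : ∀ a, (g.map (PowerSeries.constantCoeff (R := k))).IsRoot a → a ≠ c →
      (g.map (PowerSeries.constantCoeff (R := k))).rootMultiplicity a = 1)
    (hc2 : PowerSeries.coeff 2 (g.eval (PowerSeries.C c)) ≠ 0) :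
    ∃ (S : Finset (PowerSeries k)) (z1 z2 : PowerSeries k), g.natDegree ≤ S.card ∧
      (∀ z ∈ S, g.eval z = 0) ∧ z1 ≠ z2 ∧ z1 ∈ S ∧ z2 ∈ S ∧ rescale (-1 : k) z1 = z2 ∧
      rescale (-1 : k) z2 = z1 ∧ ∀ z ∈ S, z ≠ z1 → z ≠ z2 → rescale (-1 : k) z = z := by
  classical
  set gb := g.map (PowerSeries.constantCoeff (R := k)) with hgb
  have hgb1 : gb.Monic := hg.map _
  have hgb0 : gb ≠ 0 := hgb1.ne_zero
  have hevσ : ∀ z, rescale (-1 : k) (g.eval z) = g.eval (rescale (-1 : k) z) := by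
    intro z
    rw [← eval₂_hom, ← eval_map, hσ]
  have hconst : ∀ z : PowerSeries k, PowerSeries.constantCoeff (rescale (-1 : k) z)
      = PowerSeries.constantCoeff z := by
    intro z
    rw [← PowerSeries.coeff_zero_eq_constantCoeff_apply, PowerSeries.coeff_rescale]; simp
  have hCσ : ∀ a : k, rescale (-1 : k) (PowerSeries.C a) = PowerSeries.C a := by
    intro a; ext n
    rw [PowerSeries.coeff_rescale, PowerSeries.coeff_C]
    by_cases h : n = 0 <;> simp [h]
  have hevc : ∀ (q : (PowerSeries k)[X]) (z : PowerSeries k),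
      PowerSeries.constantCoeff (q.eval z) = (q.map (PowerSeries.constantCoeff (R := k))).eval
      (PowerSeries.constantCoeff z) := by
    intro q z; rw [eval_map, eval₂_hom]
  have hlift : ∀ a, gb.IsRoot a → a ≠ c →
      ∃ z, g.eval z = 0 ∧ PowerSeries.constantCoeff z = a ∧ rescale (-1 : k) z = z := by
    intro a ha hac
    have h1 := hsimple a ha hac
    have hd : (derivative gb).eval a ≠ 0 := by
      intro h0
      have := (one_lt_rootMultiplicity_iff_isRoot hgb0 (t := a)).2 ⟨ha, h0⟩
      omega
    have hd' : ∀ z : PowerSeries k, PowerSeries.constantCoeff z = a →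
        PowerSeries.constantCoeff (g.derivative.eval z) ≠ 0 := by
      intro z hz
      rw [hevc, ← derivative_map, hz]; exact hd
    obtain ⟨z, hz, hza⟩ := ps_hensel g a (by rw [hevc, PowerSeries.constantCoeff_C]; exact ha)
      (hd' _ (PowerSeries.constantCoeff_C a))
    refine ⟨z, hz, hza, ?_⟩
    apply IsLocalRing.eq_of_eval_eq_zero_of_not_isUnit_sub (f := g)
    · rw [← hevσ, hz, map_zero]
    · exact hz
    · rw [PowerSeries.isUnit_iff_constantCoeff, map_sub, hconst, sub_self]
      exact not_isUnit_zero
    · rw [PowerSeries.isUnit_iff_constantCoeff, isUnit_iff_ne_zero]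
      exact hd' _ (by rw [hconst, hza])
  have hrc : gb.IsRoot c ∧ (derivative gb).IsRoot c := by
    rw [← one_lt_rootMultiplicity_iff_isRoot hgb0]; omega
  set t := g.taylor (PowerSeries.C c) with ht
  have ht0 : t.coeff 0 = g.eval (PowerSeries.C c) := taylor_coeff_zero _ _
  have ht1 : t.coeff 1 = g.derivative.eval (PowerSeries.C c) := taylor_coeff_one _ _
  obtain ⟨e, he⟩ : ∃ e, t.coeff 0 = PowerSeries.X ^ 2 * e := by
    apply even_dvd h2
    · rw [ht0, hevσ, hCσ]
    · rw [ht0, hevc, PowerSeries.constantCoeff_C]; exact hrc.1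
  obtain ⟨e1, he1⟩ : ∃ e, t.coeff 1 = PowerSeries.X ^ 2 * e := by
    apply even_dvd h2
    · rw [ht1, ← eval₂_hom, ← eval_map, ← derivative_map, hσ, hCσ]
    · rw [ht1, hevc, PowerSeries.constantCoeff_C, ← derivative_map]; exact hrc.2
  have he0 : PowerSeries.constantCoeff e ≠ 0 := by
    rw [← ht0, he] at hc2
    have := PowerSeries.coeff_X_pow_mul e 2 0
    rw [zero_add] at this
    rw [this] at hc2
    rwa [PowerSeries.coeff_zero_eq_constantCoeff_apply] at hc2
  set s := t.divX.divX with hs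
  have hts : t = C (t.coeff 0) + C (t.coeff 1) * X + s * X ^ 2 := by
    have h1 := divX_mul_X_add t
    have h3 := divX_mul_X_add t.divX
    rw [coeff_divX, zero_add] at h3
    rw [← hs] at h3
    linear_combination (-1 : (PowerSeries k)[X]) * h1 - X * h3
  set s0 := PowerSeries.constantCoeff (s.eval 0) with hs0
  have hs0' : s0 ≠ 0 := by
    intro h0
    have h3 : (X - C c) ^ 3 ∣ gb := by
      have h4 : (taylor c gb) = X ^ 3 * (s.map (PowerSeries.constantCoeff (R := k))).divX := by
        have : taylor c gb = t.map (PowerSeries.constantCoeff (R := k)) := by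
          rw [ht, hgb, taylor_apply, taylor_apply, Polynomial.map_comp]
          simp
        rw [this, hts, he, he1]
        have h5 := divX_mul_X_add (s.map (PowerSeries.constantCoeff (R := k)))
        rw [coeff_zero_eq_eval_zero, ← map_zero (PowerSeries.constantCoeff (R := k)), ← hevc, 
          ← hs0, h0, map_zero, add_zero] at h5
        simp only [Polynomial.map_add, Polynomial.map_mul, Polynomial.map_pow, map_C, map_X,
          map_mul, map_pow, PowerSeries.constantCoeff_X]
        rw [C_0]
        linear_combination (-X ^ 2) * h5
      have h6 : gb = (taylor c gb).comp (X - C c) := by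
        rw [taylor_apply, comp_assoc]; simp
      rw [h6, h4]
      simp
    rw [← le_rootMultiplicity_iff hgb0] at h3
    omega
  let w : PowerSeries k := PowerSeries.X
  let G : (PowerSeries k)[X] := C e + C (w * e1) * X + X ^ 2 * s.comp (C w * X)
  have hGev : ∀ y, g.eval (PowerSeries.C c + w * y) = w ^ 2 * G.eval y := by
    intro y
    have : g.eval (PowerSeries.C c + w * y) = t.eval (w * y) := by
      rw [ht, taylor_eval, add_comm]
    rw [this, hts, he, he1]
    simp only [G, eval_add, eval_mul, eval_C, eval_X, eval_pow, eval_comp]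
    simp only [w]
    ring
  obtain ⟨y0, hy0⟩ := IsAlgClosed.exists_pow_nat_eq (-PowerSeries.constantCoeff e / s0)
    (n := 2) (by norm_num)
  have hy0e : PowerSeries.constantCoeff e + y0 ^ 2 * s0 = 0 := by
    rw [hy0]; field_simp; ring
  have hy00 : y0 ≠ 0 := by
    rintro rfl
    apply he0
    linear_combination hy0e
  have hsw : ∀ (q : (PowerSeries k)[X]) (y : PowerSeries k),
      PowerSeries.constantCoeff (q.eval (w * y)) = PowerSeries.constantCoeff (q.eval 0) := by
    intro q y
    rw [hevc, hevc]; simp [w]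
  have q1 : PowerSeries.constantCoeff (G.eval (PowerSeries.C y0)) = 0 := by
    have : PowerSeries.constantCoeff (G.eval (PowerSeries.C y0))
        = PowerSeries.constantCoeff e + y0 ^ 2 * s0 := by
      simp only [G, eval_add, eval_mul, eval_C, eval_X, eval_pow, eval_comp, map_add, map_mul,
        map_pow, PowerSeries.constantCoeff_C, hsw]
      simp [w, hs0]
    rw [this, hy0e]
  have q2 : PowerSeries.constantCoeff (G.derivative.eval (PowerSeries.C y0)) ≠ 0 := by
    have : PowerSeries.constantCoeff (G.derivative.eval (PowerSeries.C y0)) = 2 * y0 * s0 := by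
      simp only [G, derivative_add, derivative_mul, derivative_C, derivative_X, derivative_pow,
        derivative_comp, eval_add, eval_mul, eval_C, eval_X, eval_pow, eval_comp, map_add, map_mul,
        map_pow, PowerSeries.constantCoeff_C, hsw]
      have hc2' : PowerSeries.constantCoeff (2 : PowerSeries k) = 2 := map_ofNat _ 2
      simp [w, hs0, hc2']
    rw [this]
    exact mul_ne_zero (mul_ne_zero h2 hy00) hs0'
  obtain ⟨y, hy, hyc⟩ := ps_hensel G y0 q1 q2
  set z1 := PowerSeries.C c + w * y with hz1
  have hgz1 : g.eval z1 = 0 := by rw [hGev, hy, mul_zero]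
  have hz1c : PowerSeries.constantCoeff z1 = c := by
    simp [hz1, w]
  have hz12 : z1 ≠ rescale (-1 : k) z1 := by
    intro h
    have h1 := even_coeff_one h2 z1 h.symm
    have h3 : PowerSeries.coeff 1 z1 = y0 := by
      rw [hz1, map_add, PowerSeries.coeff_C]
      have := PowerSeries.coeff_X_pow_mul y 1 0
      rw [pow_one, zero_add] at this
      rw [this, PowerSeries.coeff_zero_eq_constantCoeff_apply, hyc]; simp
    exact hy00 (h3.symm.trans h1)
  choose! lf hlf using hlift
  have hmem : ∀ a, a ∈ gb.roots.toFinset.erase c ↔ a ≠ c ∧ gb.IsRoot a := by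
    intro a
    rw [Finset.mem_erase, Multiset.mem_toFinset, mem_roots hgb0]
  refine ⟨insert z1 (insert (rescale (-1 : k) z1) ((gb.roots.toFinset.erase c).image lf)), z1,
    rescale (-1 : k) z1, ?_, ?_, hz12, ?_, ?_, rfl, rescale_neg_one_twice _, ?_⟩
  · have hni : ∀ z, PowerSeries.constantCoeff z = c →
        z ∉ ((gb.roots.toFinset.erase c).image lf) := by
      intro z hz hmm
      rw [Finset.mem_image] at hmm
      obtain ⟨a, ha, rfl⟩ := hmm
      rw [hmem] at ha
      exact ha.1 ((hlf a ha.2 ha.1).2.1.symm.trans hz)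
    rw [Finset.card_insert_of_notMem, Finset.card_insert_of_notMem, Finset.card_image_of_injOn]
    · have h1 : g.natDegree = gb.roots.card := by
        rw [splits_iff_card_roots.1 (IsAlgClosed.splits gb), hgb, hg.natDegree_map]
      have h3 : gb.roots.card = ∑ a ∈ gb.roots.toFinset, gb.roots.count a :=
        (Multiset.toFinset_sum_count_eq _).symm
      have hcm : c ∈ gb.roots.toFinset := by
        rw [Multiset.mem_toFinset, mem_roots hgb0]; exact hrc.1
      rw [← Finset.add_sum_erase _ _ hcm, count_roots, hmult,
        Finset.sum_congr rfl (g := fun _ => 1), Finset.sum_const] at h3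
      · rw [h1, h3]; simp; omega
      · intro a ha
        rw [hmem] at ha
        rw [count_roots]; exact hsimple a ha.2 ha.1
    · intro a ha b hb hab
      have ha' := (hmem a).1 ha
      have hb' := (hmem b).1 hb
      rw [← (hlf a ha'.2 ha'.1).2.1, ← (hlf b hb'.2 hb'.1).2.1, hab]
    · exact hni _ (by rw [hconst]; exact hz1c)
    · rw [Finset.mem_insert, not_or]
      exact ⟨hz12, hni _ hz1c⟩
  · intro z hz
    rw [Finset.mem_insert, Finset.mem_insert, Finset.mem_image] at hz
    rcases hz with rfl | rfl | ⟨a, ha, rfl⟩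
    · exact hgz1
    · rw [← hevσ, hgz1, map_zero]
    · rw [hmem] at ha
      exact (hlf a ha.2 ha.1).1
  · simp
  · simp
  · intro z hz h1 h3
    rw [Finset.mem_insert, Finset.mem_insert, Finset.mem_image] at hz
    rcases hz with rfl | rfl | ⟨a, ha, rfl⟩
    · exact absurd rfl h1
    · exact absurd rfl h3
    · rw [hmem] at ha
      exact (hlf a ha.2 ha.1).2.2

end local_swap

lemma polyIter_map {R S : Type*} [CommRing R] [CommRing S] (f : R →+* S) (φ : R[X]) (n : ℕ) :
    (polyIter φ n).map f = polyIter (φ.map f) n := by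
  induction n with
  | zero => simp [polyIter]
  | succ n ih => simp only [polyIter, Polynomial.map_comp, ih]

lemma polyIter_succ' {R : Type*} [CommRing R] (φ : R[X]) (n : ℕ) :
    polyIter φ (n + 1) = (polyIter φ n).comp φ := by
  induction n with
  | zero => simp [polyIter]
  | succ n ih =>
    conv_lhs => rw [polyIter, ih]
    rw [polyIter, comp_assoc]

lemma polyIter_eval_add {R : Type*} [CommRing R] (φ : R[X]) (m n : ℕ) (x : R) :
    (polyIter φ m).eval ((polyIter φ n).eval x) = (polyIter φ (m + n)).eval x := by
  induction m with
  | zero => simp [polyIter]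
  | succ m ih => rw [Nat.succ_add]; simp only [polyIter, eval_comp, ih]

/-- The trinomial `x^p + A x^{p-1} + B`. -/
noncomputable def tri (p : ℕ) {R : Type*} [CommRing R] (A B : R) : R[X] :=
  X ^ p + C A * X ^ (p - 1) + C B

lemma tri_map (p : ℕ) {R S : Type*} [CommRing R] [CommRing S] (f : R →+* S) (A B : R) :
    (tri p A B).map f = tri p (f A) (f B) := by
  simp [tri]

lemma tri_eval (p : ℕ) {R : Type*} [CommRing R] (A B x : R) :
    (tri p A B).eval x = x ^ p + A * x ^ (p - 1) + B := by
  simp [tri]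

lemma tri_natDegree_lt (p : ℕ) (hp : 2 ≤ p) {R : Type*} [CommRing R] [Nontrivial R] (A B : R) :
    (C A * X ^ (p - 1) + C B : R[X]).degree < ((p : ℕ) : WithBot ℕ) := by
  apply lt_of_le_of_lt (degree_add_le _ _)
  rw [max_lt_iff]
  constructor
  · exact lt_of_le_of_lt (degree_C_mul_X_pow_le _ _) (by exact_mod_cast Nat.sub_lt (by omega) one_pos)
  · exact lt_of_le_of_lt degree_C_le (by exact_mod_cast (by omega : 0 < p))

lemma tri_monic (p : ℕ) (hp : 2 ≤ p) {R : Type*} [CommRing R] [Nontrivial R] (A B : R) :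
    (tri p A B).Monic := by
  rw [tri, add_assoc]
  exact monic_X_pow_add (tri_natDegree_lt p hp A B)

lemma tri_natDegree (p : ℕ) (hp : 2 ≤ p) {R : Type*} [CommRing R] [Nontrivial R] (A B : R) :
    (tri p A B).natDegree = p := by
  rw [tri, add_assoc]
  apply natDegree_eq_of_degree_eq_some
  rw [degree_add_eq_left_of_degree_lt] <;> rw [degree_X_pow]
  exact tri_natDegree_lt p hp A B

lemma polyIter_monic (p : ℕ) (hp : 2 ≤ p) {R : Type*} [CommRing R] [IsDomain R] (φ : R[X])
    (h : φ.Monic) (hd : φ.natDegree = p) (n : ℕ) :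
    (polyIter φ n).Monic ∧ (polyIter φ n).natDegree = p ^ n := by
  induction n with
  | zero => simp [polyIter, monic_X]
  | succ n ih =>
    rw [polyIter]
    constructor
    · apply h.comp ih.1
      rw [ih.2]; positivity
    · rw [natDegree_comp, hd, ih.2, pow_succ']

/-- The denominator `D`. -/
noncomputable def Dpol (k : Type*) [Field k] (p : ℕ) : k[X] :=
  (p : k[X]) * X ^ (p - 1) + ((p : k[X]) - 1)

/-- `Z = t^p + t`. -/
noncomputable def Zpol (k : Type*) [Field k] (p : ℕ) : k[X] := X ^ p + X

/-- numerators of the critical orbit. -/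
noncomputable def upol (k : Type*) [Field k] (p : ℕ) : ℕ → k[X]
  | 0 => ((p : k[X]) - 1) * Zpol k p
  | j + 1 => upol k p j ^ p - (p : k[X]) * Zpol k p * upol k p j ^ (p - 1) * Dpol k p ^ (p ^ j - 1)
      + X * Dpol k p ^ (p ^ (j + 1))

lemma upol_spec {k : Type*} [Field k] (p : ℕ) (hp : 2 ≤ p) {R : Type*} [CommRing R]
    (j : k[X] →+* R) (A : R) (hA : A * j (Dpol k p) = - (p : R) * j (Zpol k p)) (m : ℕ) :
    (polyIter (tri p A (j X)) (m + 2)).eval 0 * j (Dpol k p) ^ (p ^ m) = j (upol k p m) := by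
  induction m with
  | zero =>
    have h1 : p - 1 ≠ 0 := by omega
    have h0 : p ≠ 0 := by omega
    simp only [polyIter, eval_comp, tri_eval, eval_X, upol, zero_pow h0, zero_pow h1]
    rw [pow_zero, pow_one]
    have hD : j (Dpol k p) = p * j X ^ (p - 1) + (p - 1) := by simp [Dpol]
    have hZ : j (Zpol k p) = j X ^ p + j X := by simp [Zpol]
    rw [map_mul, map_sub, map_one, map_natCast]
    have e : (j X ^ p + A * j X ^ (p - 1) + j X) * j (Dpol k p)
      = (p - 1) * j (Zpol k p) := by
      linear_combination j X ^ (p - 1) * hA + (j X ^ p + j X) * hD + (-p * j X ^ (p - 1) - (p - 1)) * hZ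
    simpa using e
  | succ m ih =>
    have he : 1 ≤ p ^ m := Nat.one_le_pow _ _ (by omega)
    set x := (polyIter (tri p A (j X)) (m + 2)).eval 0 with hx
    have hx' : (polyIter (tri p A (j X)) (m + 1 + 2)).eval 0 = x ^ p + A * x ^ (p - 1) + j X := by
      change (polyIter (tri p A (j X)) (m + 2 + 1)).eval 0 = _
      rw [polyIter, eval_comp, tri_eval]
    rw [hx', upol]
    simp only [map_add, map_sub, map_mul, map_pow, map_natCast]
    rw [← ih]
    set d := j (Dpol k p)
    have e1 : d ^ p ^ (m + 1) = (d ^ p ^ m) ^ p := by rw [← pow_mul, pow_succ]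
    have e2 : d ^ p ^ m = d * d ^ (p ^ m - 1) := by rw [← pow_succ']; congr 1; omega
    have e3 : (d ^ p ^ m) ^ p = (d ^ p ^ m) ^ (p - 1) * d ^ p ^ m := by
      rw [← pow_succ]; congr 1; omega
    rw [mul_pow, mul_pow, e1]
    linear_combination (A * x ^ (p - 1)) * e3 + A * x ^ (p - 1) * (d ^ p ^ m) ^ (p - 1) * e2 
      + x ^ (p - 1) * (d ^ p ^ m) ^ (p - 1) * d ^ (p ^ m - 1) * hA

/-- The coefficient `A` over `k(t)`. -/
noncomputable def AK (k : Type*) [Field k] (p : ℕ) : RatFunc k :=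
  -(p : RatFunc k) * algebraMap k[X] (RatFunc k) (Zpol k p) / algebraMap k[X] (RatFunc k) (Dpol k p)

/-- The trinomial over `k(t)`. -/
noncomputable def phiK (k : Type*) [Field k] (p : ℕ) : (RatFunc k)[X] :=
  tri p (AK k p) (algebraMap k[X] (RatFunc k) X)

lemma phiK_spec {k : Type*} [Field k] (p : ℕ) {O L : Type*} [CommRing O] [Field L] [Algebra O L]
    (j : k[X] →+* O) (ι : RatFunc k →+* L)
    (hι : ∀ f, ι (algebraMap k[X] (RatFunc k) f) = algebraMap O L (j f))
    (hD : algebraMap O L (j (Dpol k p)) ≠ 0) (A : O)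
    (hA : A * j (Dpol k p) = -(p : O) * j (Zpol k p)) (n : ℕ) :
    (polyIter (phiK k p) n).map ι = (polyIter (tri p A (j X)) n).map (algebraMap O L) := by
  rw [polyIter_map, polyIter_map, phiK, tri_map, tri_map, hι]
  congr 2
  rw [AK, map_div₀, map_mul, hι, hι, div_eq_iff hD, ← map_mul, hA]
  simp

/-- Substitute `q` and embed in power series. -/
noncomputable def jhom {k : Type*} [Field k] (q : k[X]) : k[X] →+* PowerSeries k :=
  (Polynomial.coeToPowerSeries.ringHom).comp (compRingHom q)

lemma jhom_apply {k : Type*} [Field k] (q f : k[X]) : jhom q f = ((f.comp q : k[X]) : PowerSeries k) := rfl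

lemma jhom_inj {k : Type*} [Field k] (q : k[X]) (hq : q.natDegree ≠ 0) :
    Function.Injective (jhom q) := by
  rw [injective_iff_map_eq_zero]
  intro f hf
  rw [jhom_apply, Polynomial.coe_eq_zero_iff, comp_eq_zero_iff] at hf
  rcases hf with h | ⟨_, h⟩
  · exact h
  · exfalso; apply hq; rw [h]; simp

lemma jhom_const {k : Type*} [Field k] (q f : k[X]) :
    PowerSeries.constantCoeff (jhom q f) = f.eval (q.eval 0) := by
  rw [jhom_apply, ← PowerSeries.coeff_zero_eq_constantCoeff_apply, Polynomial.coeff_coe,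
    coeff_zero_eq_eval_zero, eval_comp]

/-- The induced map of fraction fields. -/
lemma exists_iota {k : Type*} [Field k] (q : k[X]) (hq : q.natDegree ≠ 0) :
    ∃ ι : RatFunc k →+* FractionRing (PowerSeries k),
      ∀ f, ι (algebraMap k[X] (RatFunc k) f) = algebraMap _ _ (jhom q f) := by
  have hinj : Function.Injective ((algebraMap (PowerSeries k) (FractionRing (PowerSeries k))).comp (jhom q)) := by
    rw [RingHom.coe_comp]
    exact (IsFractionRing.injective _ _).comp (jhom_inj q hq)
  exact ⟨IsFractionRing.lift hinj, fun f => IsFractionRing.lift_algebraMap hinj f⟩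

lemma exists_AO {k : Type*} [Field k] (p : ℕ) (q : k[X]) (h : (Dpol k p).eval (q.eval 0) ≠ 0) :
    ∃ A : PowerSeries k, A * jhom q (Dpol k p) = -(p : PowerSeries k) * jhom q (Zpol k p) ∧
      IsUnit (jhom q (Dpol k p)) := by
  have hu : IsUnit (jhom q (Dpol k p)) := by
    rw [PowerSeries.isUnit_iff_constantCoeff, jhom_const]
    exact h.isUnit
  obtain ⟨b, hb⟩ := hu.exists_left_inv
  exact ⟨-(p : PowerSeries k) * jhom q (Zpol k p) * b, by rw [mul_assoc, hb, mul_one], hu⟩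

lemma tri_zero (p : ℕ) {R : Type*} [CommRing R] (n : ℕ) :
    polyIter (tri p (0 : R) 0) n = X ^ (p ^ n) := by
  induction n with
  | zero => simp [polyIter]
  | succ n ih => rw [polyIter, ih, tri]; simp [← pow_mul, pow_succ]

lemma polyIter_natDegree {R : Type*} [CommRing R] [IsDomain R] (p : ℕ) (hp : 2 ≤ p) (A B : R) (n : ℕ) :
    (polyIter (tri p A B) n).Monic ∧ (polyIter (tri p A B) n).natDegree = p ^ n :=
  polyIter_monic p hp _ (tri_monic p hp A B) (tri_natDegree p hp A B) n

lemma f_irreducible {k : Type*} [Field k] (p : ℕ) (hp3 : 3 ≤ p) (hp1 : (p : k) - 1 ≠ 0) (n : ℕ)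
    (hn : 1 ≤ n) : Irreducible (polyIter (phiK k p) n) := by
  have hq : (X : k[X]).natDegree ≠ 0 := by simp
  obtain ⟨ι, hι⟩ := exists_iota (X : k[X]) hq
  have hD0 : (Dpol k p).eval ((X : k[X]).eval 0) ≠ 0 := by
    have : p - 1 ≠ 0 := by omega
    simpa [Dpol, zero_pow this] using hp1
  obtain ⟨A, hA, hu⟩ := exists_AO p X hD0
  have hjX : jhom (X : k[X]) X = PowerSeries.X := by simp [jhom_apply]
  have hDne : algebraMap _ (FractionRing (PowerSeries k)) (jhom X (Dpol k p)) ≠ 0 :=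
    (hu.map _).ne_zero
  have hs := phiK_spec p (jhom X) ι hι hDne A hA n
  obtain ⟨hm, hd⟩ := polyIter_natDegree p (by omega) A (jhom X X) n
  obtain ⟨hmK, hdK⟩ := polyIter_natDegree p (by omega) (AK k p) (algebraMap k[X] (RatFunc k) X) n
  apply Monic.irreducible_of_irreducible_map ι _ hmK
  change Irreducible ((polyIter (phiK k p) n).map ι)
  rw [hs, ← Monic.irreducible_iff_irreducible_map_fraction_map hm]
  have hA0 : PowerSeries.constantCoeff A = 0 := by
    have := congrArg PowerSeries.constantCoeff hA
    rw [map_mul, map_mul, jhom_const, jhom_const] at this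
    have hz : (Zpol k p).eval ((X : k[X]).eval 0) = 0 := by
      have : p ≠ 0 := by omega
      simp [Zpol, zero_pow this]
    rw [hz, mul_zero] at this
    exact (mul_eq_zero.mp this).resolve_right hD0
  have hXA : PowerSeries.X ∣ A := PowerSeries.X_dvd_iff.mpr hA0
  rw [hjX] at hm hd ⊢
  have hx : (PowerSeries.X ^ 2 : PowerSeries k) ∣ (polyIter (tri p A PowerSeries.X) n).eval 0 - PowerSeries.X := by
    induction n, hn using Nat.le_induction with
    | base =>
      have h1 : p - 1 ≠ 0 := by omega
      have h0 : p ≠ 0 := by omega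
      simp [polyIter, tri_eval, h0, h1]
    | succ n hn ih =>
      have hs' := phiK_spec p (jhom X) ι hι hDne A hA n
      obtain ⟨a1, a2⟩ := polyIter_natDegree p (by omega) A (PowerSeries.X) n
      obtain ⟨b1, b2⟩ := polyIter_natDegree p (by omega) (AK k p) (algebraMap k[X] (RatFunc k) X) n
      have ih' := ih (by assumption) (by assumption) (by assumption) (by assumption) (by assumption)
      have hd1 : (PowerSeries.X : PowerSeries k) ∣ (polyIter (tri p A PowerSeries.X) n).eval 0 := by
        have h := dvd_trans (dvd_pow_self PowerSeries.X two_ne_zero) ih'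
        have := dvd_add h (dvd_refl PowerSeries.X)
        simpa using this
      rw [polyIter, eval_comp, tri_eval, add_sub_cancel_right]
      apply dvd_add
      · exact dvd_trans (pow_dvd_pow _ (by omega)) (pow_dvd_pow_of_dvd hd1 p)
      · rw [sq]
        exact mul_dvd_mul hXA (dvd_trans hd1 (dvd_pow_self _ (by omega)))
  have hmap : (polyIter (tri p A PowerSeries.X) n).map PowerSeries.constantCoeff = X ^ (p ^ n) := by
    rw [polyIter_map, tri_map, hA0, PowerSeries.constantCoeff_X, tri_zero]
  have hE : (polyIter (tri p A PowerSeries.X) n).IsEisensteinAt (Ideal.span {PowerSeries.X}) := by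
    refine ⟨?_, ?_, ?_⟩
    · rw [hm.leadingCoeff, Ideal.mem_span_singleton, PowerSeries.X_dvd_iff]
      simp
    · intro i hi
      rw [hd] at hi
      rw [Ideal.mem_span_singleton, PowerSeries.X_dvd_iff, ← coeff_map, hmap, coeff_X_pow,
        if_neg (by omega)]
    · rw [Ideal.span_singleton_pow, Ideal.mem_span_singleton, coeff_zero_eq_eval_zero]
      intro h
      have h2 := dvd_sub h hx
      rw [sub_sub_cancel, PowerSeries.X_pow_dvd_iff] at h2
      have := h2 1 (by norm_num)
      simp at this
  refine hE.irreducible PowerSeries.span_X_isPrime hm.isPrimitive ?_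
  rw [hd]; positivity

lemma f_separable {k : Type*} [Field k] (p : ℕ) (hp3 : 3 ≤ p) (hp0 : (p : k) ≠ 0)
    (hp1 : (p : k) - 1 ≠ 0) (n : ℕ)
    (hn : 1 ≤ n) : (polyIter (phiK k p) n).Separable := by
  rw [separable_iff_derivative_ne_zero (f_irreducible p hp3 hp1 n hn)]
  intro h
  obtain ⟨hmK, hdK⟩ := polyIter_natDegree p (by omega) (AK k p) (algebraMap k[X] (RatFunc k) X) n
  have h1 := congrArg (fun f => coeff f (p ^ n - 1)) h
  simp only [coeff_derivative, coeff_zero] at h1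
  have h2 : p ^ n - 1 + 1 = p ^ n := Nat.sub_add_cancel (Nat.one_le_pow _ _ (by omega))
  rw [h2] at h1
  have h3 : (polyIter (phiK k p) n).coeff (p ^ n) = 1 := by rw [← hdK]; exact hmK
  rw [h3, one_mul] at h1
  have h4 : ((p ^ n - 1 + 1 : ℕ) : RatFunc k) = 0 := by push_cast; exact h1
  rw [h2] at h4
  push_cast at h4
  have h5 : (p : RatFunc k) = 0 := pow_eq_zero_iff (by omega) |>.mp h4
  apply hp0
  have : (algebraMap k (RatFunc k)) (p : k) = 0 := by rw [map_natCast, h5]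
  exact (map_eq_zero _).mp this

lemma polyIter_deriv_zero {R : Type*} [CommRing R] [IsDomain R] (φ : R[X]) (n : ℕ) (r : R)
    (h : (derivative (polyIter φ n)).eval r = 0) :
    ∃ i < n, (derivative φ).eval ((polyIter φ i).eval r) = 0 := by
  induction n with
  | zero => simp [polyIter] at h
  | succ n ih =>
    rw [polyIter, derivative_comp, eval_mul, eval_comp] at h
    rcases mul_eq_zero.mp h with h | h
    · obtain ⟨i, hi, h'⟩ := ih h
      exact ⟨i, by omega, h'⟩
    · exact ⟨n, by omega, h⟩

/-- Multiplicities of the roots of a special fibre. -/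
lemma fibre_mult {k : Type*} [Field k] (p : ℕ) (hp3 : 3 ≤ p) (hp0 : (p : k) ≠ 0)
    (h2 : (2 : k) ≠ 0) (A a c : k) (hc : (tri p A a).eval a = c)
    (hcA : (p : k) * c = -((p : k) - 1) * A) (n : ℕ)
    (hx : ∀ i, 1 ≤ i → i < n + 3 → (polyIter (tri p A a) i).eval 0 ≠ 0)
    (hx0 : (polyIter (tri p A a) (n + 3)).eval 0 = 0) :
    (polyIter (tri p A a) (n + 1)).rootMultiplicity c = 2 ∧
    (∀ r, (polyIter (tri p A a) (n + 1)).IsRoot r → r ≠ c →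
      (polyIter (tri p A a) (n + 1)).rootMultiplicity r = 1) ∧
    (derivative (polyIter (tri p A a) (n + 1))).eval c = 0 := by
  set φ := tri p A a with hφ
  have hφ' : derivative φ = C (p : k) * X ^ (p - 2) * (X - C c) := by
    obtain ⟨q, rfl⟩ : ∃ q, p = q + 3 := ⟨p - 3, by omega⟩
    have e : C ((q + 3 : ℕ) : k) * C c = -(C ((q + 3 : ℕ) : k) - 1) * C A := by
      rw [← C_mul, hcA]; simp
    have e1 : q + 3 - 1 = q + 2 := rfl
    have e2 : q + 3 - 2 = q + 1 := rfl
    rw [hφ, tri, e1, e2]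
    simp only [derivative_add, derivative_X_pow, derivative_C, derivative_mul]
    have e1 : q + 3 - 1 = q + 2 := rfl
    have e2 : q + 2 - 1 = q + 1 := rfl
    rw [e1, e2]
    have e3 : (C ((q + 2 : ℕ) : k) : k[X]) = C ((q + 3 : ℕ) : k) - 1 := by
      rw [← C_1, ← C_sub]; congr 1; push_cast; ring
    rw [e3]
    linear_combination X ^ (q + 1) * e
  have hc2 : (polyIter φ 2).eval 0 = c := by
    have h1 : p - 1 ≠ 0 := by omega
    have h0 : p ≠ 0 := by omega
    have : φ.eval 0 = a := by rw [hφ, tri_eval, zero_pow h0, zero_pow h1]; ring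
    simp only [polyIter, eval_comp, eval_X, this]; exact hc
  have hc0 : c ≠ 0 := by rw [← hc2]; exact hx 2 (by omega) (by omega)
  have hcrit : ∀ y, (derivative φ).eval y = 0 → y = 0 ∨ y = c := by
    intro y hy
    rw [hφ'] at hy
    simp only [eval_mul, eval_C, eval_pow, eval_X, eval_sub, mul_eq_zero, hp0, false_or] at hy
    rcases hy with h | h
    · left; exact pow_eq_zero_iff (by omega) |>.mp h
    · right; exact sub_eq_zero.mp h
  have hcc : ∀ i, (polyIter φ i).eval c = (polyIter φ (i + 2)).eval 0 := by
    intro i; rw [← polyIter_eval_add, hc2]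
  have key : ∀ i < n + 1, ∀ r, (polyIter φ (n + 1)).eval r = 0 →
      (derivative φ).eval ((polyIter φ i).eval r) = 0 → i = 0 ∧ r = c := by
    intro i hi r hr h
    have hsplit : (polyIter φ (n + 1)).eval r = (polyIter φ (n + 1 - i)).eval ((polyIter φ i).eval r) := by
      rw [polyIter_eval_add]; congr 2; omega
    rw [hsplit] at hr
    rcases hcrit _ h with h | h
    · rw [h] at hr
      exact absurd hr (hx _ (by omega) (by omega))
    · rw [h, hcc] at hr
      have hi0 : i = 0 := by
        by_contra h0
        exact hx _ (by omega) (by omega) hr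
      subst hi0
      refine ⟨rfl, ?_⟩
      simpa [polyIter] using h
  have hm : (polyIter φ (n + 1)).Monic := (polyIter_natDegree p (by omega) A a (n + 1)).1
  have hroot : (polyIter φ (n + 1)).eval c = 0 := by rw [hcc]; exact hx0
  have hφc : (derivative φ).eval c = 0 := by rw [hφ']; simp
  have hd : derivative (polyIter φ (n + 1)) = derivative φ * (derivative (polyIter φ n)).comp φ := by
    rw [polyIter_succ', derivative_comp]
  have hd0 : (derivative (polyIter φ (n + 1))).eval c = 0 := by
    rw [hd, eval_mul, hφc, zero_mul]
  refine ⟨?_, ?_, hd0⟩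
  · apply le_antisymm
    · by_contra hlt
      push Not at hlt
      rw [lt_rootMultiplicity_iff_isRoot_iterate_derivative_of_mem_nonZeroDivisors hm.ne_zero
        (by simpa using h2)] at hlt
      have h := hlt 2 le_rfl
      simp only [Function.iterate_succ, Function.iterate_zero, Function.comp_apply, id_eq, IsRoot.def] at h
      rw [hd, derivative_mul, eval_add, eval_mul, eval_mul, hφc, zero_mul, add_zero, eval_comp] at h
      rcases mul_eq_zero.mp h with h | h
      · rw [hφ'] at h
        simp [derivative_mul, hp0, hc0] at h
      · obtain ⟨i, hi, h'⟩ := polyIter_deriv_zero φ n _ h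
        have : (polyIter φ i).eval (φ.eval c) = (polyIter φ (i + 1)).eval c := by
          rw [polyIter_succ', eval_comp]
        rw [this] at h'
        have := (key (i + 1) (by omega) c hroot h').1
        omega
    · exact (one_lt_rootMultiplicity_iff_isRoot hm.ne_zero).mpr ⟨hroot, hd0⟩
  · intro r hr hrc
    apply le_antisymm
    · by_contra hlt
      push Not at hlt
      have h := ((one_lt_rootMultiplicity_iff_isRoot hm.ne_zero).mp hlt).2
      obtain ⟨i, hi, h'⟩ := polyIter_deriv_zero φ _ _ h
      exact hrc (key i hi r hr h').2
    · exact (rootMultiplicity_pos hm.ne_zero).mpr hr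

lemma ps_dvd_two {k : Type*} [Field k] (h2 : (2 : k) ≠ 0) (z : PowerSeries k)
    (hz : PowerSeries.rescale (-1 : k) z = z) (h0 : PowerSeries.constantCoeff z = 0) :
    PowerSeries.X ^ 2 ∣ z := by
  rw [PowerSeries.X_pow_dvd_iff]
  intro m hm
  interval_cases m
  · simpa using h0
  · exact even_coeff_one h2 z hz

lemma ps_rescale_C {k : Type*} [Field k] (b : k) :
    PowerSeries.rescale (-1 : k) (PowerSeries.C b) = PowerSeries.C b := by
  ext n
  rw [PowerSeries.coeff_rescale, PowerSeries.coeff_C]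
  split_ifs with h
  · simp [h]
  · simp

lemma jhom_rescale {k : Type*} [Field k] (a : k) (f : k[X]) :
    PowerSeries.rescale (-1 : k) (jhom (X ^ 2 + C a) f) = jhom (X ^ 2 + C a) f := by
  have : (PowerSeries.rescale (-1 : k)).comp (jhom (X ^ 2 + C a)) = jhom (X ^ 2 + C a) := by
    apply Polynomial.ringHom_ext
    · intro b
      rw [RingHom.comp_apply, jhom_apply]
      simp [ps_rescale_C]
    · rw [RingHom.comp_apply, jhom_apply]
      simp [ps_rescale_C, PowerSeries.rescale_X]
  exact congrArg (fun g => g f) this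

lemma step_ineq {k : Type*} [Field k] [IsAlgClosed k] (p : ℕ) (hp : p.Prime) (hp3 : 3 ≤ p)
    (hp0 : (p : k) ≠ 0) (hp1 : (p : k) - 1 ≠ 0) (h2 : (2 : k) ≠ 0) (n : ℕ) (a : k) (ha : a ≠ 0)
    (hD : (Dpol k p).eval a ≠ 0) (hu : ∀ i < n + 1, (upol k p i).eval a ≠ 0)
    (hu0 : (upol k p (n + 1)).eval a = 0) (hu1 : (derivative (upol k p (n + 1))).eval a ≠ 0) :
    p.factorial ^ (p ^ n) * Module.finrank (RatFunc k) (polyIter (phiK k p) n).SplittingField ≤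
      Module.finrank (RatFunc k) (polyIter (phiK k p) (n + 1)).SplittingField := by
  set q : k[X] := X ^ 2 + C a with hqdef
  have hqd : q.natDegree ≠ 0 := by rw [hqdef, natDegree_X_pow_add_C]; norm_num
  have hq0 : q.eval 0 = a := by simp [hqdef]
  obtain ⟨ι, hι⟩ := exists_iota q hqd
  obtain ⟨A, hA, hunit⟩ := exists_AO p q (by rw [hq0]; exact hD)
  have hDne : algebraMap _ (FractionRing (PowerSeries k)) (jhom q (Dpol k p)) ≠ 0 :=
    (hunit.map _).ne_zero
  have hspec := phiK_spec p (jhom q) ι hι hDne A hA (n + 1)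
  have hjres : ∀ f, PowerSeries.rescale (-1 : k) (jhom q f) = jhom q f := jhom_rescale a
  have hAσ : PowerSeries.rescale (-1 : k) A = A := by
    apply hunit.mul_right_cancel
    have := congrArg (PowerSeries.rescale (-1 : k)) hA
    rw [map_mul, map_mul, map_neg, map_natCast, hjres, hjres] at this
    rw [this, hA]
  set φO := tri p A (jhom q X) with hφO
  have hφσ : φO.map (PowerSeries.rescale (-1 : k)) = φO := by
    rw [hφO, tri_map, hAσ, hjres]
  set Aa := PowerSeries.constantCoeff A with hAa
  have hcX : PowerSeries.constantCoeff (jhom q X) = a := by rw [jhom_const, hq0, eval_X]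
  have hφc : φO.map PowerSeries.constantCoeff = tri p Aa a := by
    rw [hφO, tri_map, hcX]
  have hAaD : Aa * (Dpol k p).eval a = -(p : k) * (Zpol k p).eval a := by
    have := congrArg PowerSeries.constantCoeff hA
    rw [map_mul, map_mul, map_neg, map_natCast, jhom_const, jhom_const, hq0] at this
    exact this
  have hus : ∀ m, (polyIter (tri p Aa a) (m + 2)).eval 0 * (Dpol k p).eval a ^ (p ^ m) =
      (upol k p m).eval a := by
    intro m
    have := upol_spec p (by omega) (evalRingHom a) Aa (by simpa using hAaD) m
    simpa using this
  have hp1' : p - 1 ≠ 0 := by omega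
  have hp0' : p ≠ 0 := by omega
  have hphi0 : (tri p Aa a).eval 0 = a := by
    rw [tri_eval, zero_pow hp0', zero_pow hp1']; ring
  have hx : ∀ i, 1 ≤ i → i < n + 3 → (polyIter (tri p Aa a) i).eval 0 ≠ 0 := by
    intro i hi1 hi2 h
    rcases Nat.lt_or_ge i 2 with h' | h'
    · have : i = 1 := by omega
      subst this
      apply ha
      simpa [polyIter, hphi0] using h
    · obtain ⟨m, rfl⟩ := Nat.exists_eq_add_of_le' h'
      apply hu m (by omega)
      rw [← hus, h, zero_mul]
  have hx0 : (polyIter (tri p Aa a) (n + 3)).eval 0 = 0 := by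
    have := hus (n + 1)
    rw [hu0] at this
    exact (mul_eq_zero.mp this).resolve_right (pow_ne_zero _ hD)
  set c := (tri p Aa a).eval a with hc
  have hc2 : (polyIter (tri p Aa a) 2).eval 0 = c := by
    simp only [polyIter, eval_comp, eval_X, hphi0, hc]
  have hcA : (p : k) * c = -((p : k) - 1) * Aa := by
    have h0 := hus 0
    rw [zero_add, hc2, pow_zero, pow_one, upol] at h0
    simp only [eval_mul, eval_sub, eval_natCast, eval_one] at h0
    apply mul_right_cancel₀ hD
    linear_combination (p : k) * h0 + ((p : k) - 1) * hAaD
  obtain ⟨hm1, hm2, hm3⟩ := fibre_mult p hp3 hp0 h2 Aa a c hc.symm hcA n hx hx0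
  set g := polyIter φO (n + 1) with hg
  obtain ⟨hgm, hgd⟩ := polyIter_natDegree p (by omega) A (jhom q X) (n + 1)
  have hgmap : g.map PowerSeries.constantCoeff = polyIter (tri p Aa a) (n + 1) := by
    rw [hg, polyIter_map, hφc]
  have hgσ : g.map (PowerSeries.rescale (-1 : k)) = g := by
    rw [hg, polyIter_map, hφσ]
  have hevσ : ∀ z : PowerSeries k, PowerSeries.rescale (-1 : k) z = z →
      PowerSeries.rescale (-1 : k) (g.eval z) = g.eval z := by
    intro z hz
    have := Polynomial.hom_eval₂ g (RingHom.id _) (PowerSeries.rescale (-1 : k)) z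
    rw [← eval₂_id, this, RingHom.comp_id, ← eval_map, hgσ, hz, eval₂_id]
  have hcσ : PowerSeries.rescale (-1 : k) (PowerSeries.C c) = PowerSeries.C c := by
    rw [ps_rescale_C]
  have hconst : ∀ (f : (PowerSeries k)[X]) z, PowerSeries.constantCoeff (f.eval z) =
      (f.map PowerSeries.constantCoeff).eval (PowerSeries.constantCoeff z) := by
    intro f z
    rw [eval_map, eval₂_at_apply]
  have hcoef2 : PowerSeries.coeff 2 (g.eval (PowerSeries.C c)) ≠ 0 := by
    intro h0
    have hgc : PowerSeries.X ^ 3 ∣ g.eval (PowerSeries.C c) := by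
      rw [PowerSeries.X_pow_dvd_iff]
      intro m hm
      interval_cases m
      · rw [PowerSeries.coeff_zero_eq_constantCoeff_apply, hconst, hgmap, PowerSeries.constantCoeff_C,
          ← hc2, polyIter_eval_add]
        exact hx0
      · exact even_coeff_one h2 _ (hevσ _ hcσ)
      · exact h0
    set cO := (polyIter φO 2).eval 0 with hcO
    have hcOσ : PowerSeries.rescale (-1 : k) cO = cO := by
      have := Polynomial.hom_eval₂ (polyIter φO 2) (RingHom.id _) (PowerSeries.rescale (-1 : k)) 0
      rw [hcO, ← eval₂_id, this, RingHom.comp_id, ← eval_map, polyIter_map, hφσ, map_zero, eval₂_id]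
    have hdiff : PowerSeries.X ^ 2 ∣ cO - PowerSeries.C c := by
      apply ps_dvd_two h2
      · rw [map_sub, hcOσ, hcσ]
      · rw [map_sub, hcO, hconst, polyIter_map, hφc, map_zero, hc2, PowerSeries.constantCoeff_C, sub_self]
    have hder : PowerSeries.X ∣ (derivative g).eval (PowerSeries.C c) := by
      rw [PowerSeries.X_dvd_iff, hconst, ← derivative_map, hgmap, PowerSeries.constantCoeff_C]
      exact hm3
    obtain ⟨b, hb⟩ := binomExpansion g (PowerSeries.C c) (cO - PowerSeries.C c)
    rw [add_sub_cancel] at hb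
    have h3 : PowerSeries.X ^ 3 ∣ g.eval cO := by
      rw [hb]
      apply dvd_add (dvd_add hgc _)
      · apply dvd_mul_of_dvd_right
        refine dvd_trans ?_ (pow_dvd_pow_of_dvd hdiff 2)
        rw [← pow_mul]; exact pow_dvd_pow _ (by norm_num)
      · rw [pow_succ']
        exact mul_dvd_mul hder hdiff
    have h4 : PowerSeries.X ^ 3 ∣ jhom q (upol k p (n + 1)) := by
      rw [← upol_spec p (by omega) (jhom q) A hA (n + 1)]
      apply dvd_mul_of_dvd_left
      rw [hcO, hg, polyIter_eval_add] at h3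
      exact h3
    rw [PowerSeries.X_pow_dvd_iff] at h4
    have h5 := h4 2 (by norm_num)
    obtain ⟨v, hv⟩ := dvd_iff_isRoot.mpr hu0
    rw [hv] at hu1 h5
    rw [jhom_apply, Polynomial.coeff_coe, mul_comp] at h5
    have e : (X - C a).comp q = X ^ 2 := by simp [hqdef]
    rw [e, coeff_X_pow_mul' , if_pos le_rfl, Nat.sub_self, coeff_zero_eq_eval_zero, eval_comp, hq0] at h5
    apply hu1
    simp [derivative_mul, h5]
  obtain ⟨S, z1, z2, hS1, hS2, hz12, hz1, hz2, hs1, hs2, hs3⟩ :=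
    local_swap h2 g hgm hgσ c (by rw [hgmap]; exact hm1) (by rw [hgmap]; exact hm2) hcoef2
  let _ : Algebra (RatFunc k) (FractionRing (PowerSeries k)) := ι.toAlgebra
  have hinj : Function.Injective (algebraMap (PowerSeries k) (FractionRing (PowerSeries k))) :=
    IsFractionRing.injective _ _
  let σ0 : PowerSeries k ≃+* PowerSeries k :=
    RingEquiv.ofRingHom (PowerSeries.rescale (-1 : k)) (PowerSeries.rescale (-1 : k))
      (RingHom.ext fun z => rescale_neg_one_twice z) (RingHom.ext fun z => rescale_neg_one_twice z)
  let σ1 : FractionRing (PowerSeries k) ≃+* FractionRing (PowerSeries k) :=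
    IsFractionRing.ringEquivOfRingEquiv σ0
  have hσ1 : ∀ z : PowerSeries k, σ1 (algebraMap _ _ z) = algebraMap _ _ (PowerSeries.rescale (-1 : k) z) :=
    fun z => IsFractionRing.ringEquivOfRingEquiv_algebraMap σ0 z
  have hcomm : (σ1 : FractionRing (PowerSeries k) →+* FractionRing (PowerSeries k)).comp ι = ι := by
    apply IsLocalization.ringHom_ext (nonZeroDivisors k[X])
    apply RingHom.ext
    intro f
    rw [RingHom.comp_apply, RingHom.comp_apply, RingHom.comp_apply, hι, RingEquiv.coe_toRingHom,
        hσ1, hjres]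
  let σ : FractionRing (PowerSeries k) ≃ₐ[RatFunc k] FractionRing (PowerSeries k) :=
    AlgEquiv.ofRingEquiv (f := σ1) (fun x => congrArg (fun g => g x) hcomm)
  have hσ : ∀ z : PowerSeries k, σ (algebraMap _ _ z) = algebraMap _ _ (PowerSeries.rescale (-1 : k) z) := hσ1
  have hirr := f_irreducible (k := k) p hp3 hp1 (n + 1) (by omega)
  have hsep := f_separable (k := k) p hp3 hp0 hp1 (n + 1) (by omega)
  obtain ⟨hKm, hKd⟩ := polyIter_natDegree p (by omega) (AK k p) (algebraMap k[X] (RatFunc k) X) (n + 1)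
  obtain ⟨hKm', hKd'⟩ := polyIter_natDegree p (by omega) (AK k p) (algebraMap k[X] (RatFunc k) X) n
  change (polyIter (phiK k p) (n + 1)).natDegree = _ at hKd
  change (polyIter (phiK k p) n).natDegree = _ at hKd'
  rw [polyIter_succ'] at hirr hsep hKd hspec ⊢
  rw [← hKd']
  classical
  apply swap_step (polyIter (phiK k p) n) (phiK k p) p hp (tri_natDegree p (by omega) _ _) hirr hsep
    (FractionRing (PowerSeries k)) σ (S.image (algebraMap _ _)) _ _
    (algebraMap _ _ z1) (algebraMap _ _ z2) (hinj.ne hz12) (Finset.mem_image_of_mem _ hz1)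
    (Finset.mem_image_of_mem _ hz2) (by rw [hσ, hs1]) (by rw [hσ, hs2])
  · intro z hz h1 h2
    obtain ⟨y, hy, rfl⟩ := Finset.mem_image.mp hz
    rw [hσ, hs3 y hy (fun h => h1 (by rw [h])) (fun h => h2 (by rw [h]))]
  · rw [Finset.card_image_of_injective _ hinj, hKd, ← hgd]
    exact hS1
  · intro z hz
    obtain ⟨y, hy, rfl⟩ := Finset.mem_image.mp hz
    rw [aeval_def, ← eval_map]
    change eval _ (map ι _) = 0
    rw [hspec, eval_map, eval₂_at_apply]
    have := hS2 y hy
    rw [hg] at this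
    rw [this, map_zero]

lemma natDegree_Dpol_le (k : Type*) [Field k] (p : ℕ) : (Dpol k p).natDegree ≤ p - 1 := by
  rw [Dpol]
  refine natDegree_add_le_of_degree_le ?_ ?_
  · rw [← C_eq_natCast]; exact natDegree_C_mul_X_pow_le _ _
  · rw [← C_eq_natCast, ← C_1, ← C_sub, natDegree_C]; omega

lemma natDegree_Zpol {k : Type*} [Field k] (p : ℕ) (hp : 2 ≤ p) : (Zpol k p).natDegree = p := by
  rw [Zpol, natDegree_add_eq_left_of_natDegree_lt] <;> simp; omega

/-- second factor. -/
noncomputable def Ppol (k : Type*) [Field k] (p j : ℕ) : k[X] :=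
  upol k p j - (p : k[X]) * Zpol k p * Dpol k p ^ (p ^ j - 1)

lemma upol_succ (k : Type*) [Field k] (p : ℕ) (hp : 2 ≤ p) (j : ℕ) :
    upol k p (j + 1) = upol k p j ^ (p - 1) * Ppol k p j + X * Dpol k p ^ (p ^ (j + 1)) := by
  rw [upol, Ppol]
  have : upol k p j ^ p = upol k p j ^ (p - 1) * upol k p j := by rw [← pow_succ]; congr 1; omega
  rw [this]; ring

lemma natDegree_ZD_lt {k : Type*} [Field k] (p : ℕ) (hp : 3 ≤ p) (j : ℕ) (hj : 1 ≤ j) (b : k[X])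
    (hb : b.natDegree = 0) :
    (b * Zpol k p * Dpol k p ^ (p ^ j - 1)).natDegree < p ^ (j + 1) := by
  have h1 : (b * Zpol k p * Dpol k p ^ (p ^ j - 1)).natDegree ≤ 0 + p + (p ^ j - 1) * (p - 1) := by
    refine natDegree_mul_le_of_le (natDegree_mul_le_of_le hb.le (natDegree_Zpol p (by omega)).le) ?_
    exact natDegree_pow_le_of_le _ (natDegree_Dpol_le k p)
  have h2 : p ≤ p ^ j := by
    calc p = p ^ 1 := (pow_one p).symm
      _ ≤ p ^ j := Nat.pow_le_pow_right (by omega) hj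
  rw [pow_succ]
  refine lt_of_le_of_lt h1 ?_
  clear h1
  obtain ⟨q, hq⟩ := Nat.exists_eq_add_of_le (show 1 ≤ p by omega)
  obtain ⟨e, he⟩ := Nat.exists_eq_add_of_le (show 1 ≤ p ^ j by omega)
  rw [he] at h2 ⊢
  have h3 : 1 + e - 1 = e := by omega
  have h4 : p - 1 = q := by omega
  rw [h3, h4]
  have : (1 + e) * p = 1 + q + e + e * q := by rw [hq]; ring
  omega

lemma natDegree_upol_Ppol {k : Type*} [Field k] (p : ℕ) (hp : 3 ≤ p)
    (hp1 : (p : k) - 1 ≠ 0) (j : ℕ) :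
    (upol k p j).natDegree = p ^ (j + 1) ∧ (Ppol k p j).natDegree = p ^ (j + 1) := by
  have hPof : ∀ j, 1 ≤ j → (upol k p j).natDegree = p ^ (j + 1) → (Ppol k p j).natDegree = p ^ (j + 1) := by
    intro j hj h
    rw [Ppol, natDegree_sub_eq_left_of_natDegree_lt, h]
    rw [h]
    apply natDegree_ZD_lt p hp j hj
    simp
  induction j with
  | zero =>
    have hu : (upol k p 0).natDegree = p ^ (0 + 1) := by
      rw [upol, ← C_eq_natCast, ← C_1, ← C_sub, natDegree_C_mul hp1, natDegree_Zpol p (by omega)]; simp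
    refine ⟨hu, ?_⟩
    have : Ppol k p 0 = - Zpol k p := by
      rw [Ppol, upol]; simp; ring
    rw [this, natDegree_neg, natDegree_Zpol p (by omega)]; simp
  | succ j ih =>
    have hne : 0 < p ^ (j + 1) := by positivity
    have h1 : (upol k p j ^ (p - 1) * Ppol k p j).natDegree = p ^ (j + 1 + 1) := by
      rw [natDegree_mul, natDegree_pow, ih.1, ih.2]
      · rw [pow_succ p (j + 1)]
        conv_rhs => rw [show p = p - 1 + 1 by omega]
        rw [mul_add, mul_comm, mul_one]
        congr 2 <;> congr 1 <;> omega
      · apply pow_ne_zero; intro h; rw [h] at ih; simp at ih; omega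
      · intro h; rw [h] at ih; simp at ih; omega
    have hu : (upol k p (j + 1)).natDegree = p ^ (j + 1 + 1) := by
      rw [upol_succ k p (by omega), natDegree_add_eq_left_of_natDegree_lt, h1]
      rw [h1]
      have : (X * Dpol k p ^ (p ^ (j + 1))).natDegree ≤ 1 + p ^ (j + 1) * (p - 1) :=
        natDegree_mul_le_of_le natDegree_X_le (natDegree_pow_le_of_le _ (natDegree_Dpol_le k p))
      refine lt_of_le_of_lt this ?_
      rw [pow_succ p (j + 1)]
      obtain ⟨q, hq⟩ := Nat.exists_eq_add_of_le (show 1 ≤ p by omega)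
      have h4 : p - 1 = q := by omega
      have h5 : 3 ≤ p ^ (j + 1) := le_trans hp (Nat.le_self_pow (by omega) p)
      rw [h4]
      have : p ^ (j + 1) * p = p ^ (j + 1) + p ^ (j + 1) * q := by
        have : p ^ (j + 1) * p = p ^ (j + 1) * (1 + q) := by rw [← hq]
        rw [this]; ring
      omega
    exact ⟨hu, hPof (j + 1) (by omega) hu⟩

lemma upol_ne_zero {k : Type*} [Field k] (p : ℕ) (hp : 3 ≤ p)
    (hp1 : (p : k) - 1 ≠ 0) (j : ℕ) : upol k p j ≠ 0 := by
  intro h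
  have h1 := (natDegree_upol_Ppol p hp hp1 j).1
  rw [h] at h1
  have : 0 < p ^ (j + 1) := by positivity
  simp at h1; omega

lemma Dpol_eval_zero (k : Type*) [Field k] (p : ℕ) (hp : 3 ≤ p) : (Dpol k p).eval 0 = (p : k) - 1 := by
  have : p - 1 ≠ 0 := by omega
  simp [Dpol, this]

lemma upol_eval_zero {k : Type*} [Field k] (p : ℕ) (hp : 3 ≤ p) (j : ℕ) : (upol k p j).eval 0 = 0 := by
  have : p - 1 ≠ 0 := by omega
  have : p ≠ 0 := by omega
  induction j with
  | zero => simp [upol, Zpol, this]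
  | succ j ih => simp [upol_succ k p (by omega), *]

lemma upol_ne_of_D {k : Type*} [Field k] (p : ℕ) (hp : 3 ≤ p) 
    (hp1 : (p : k) - 1 ≠ 0) (a : k) (ha : (Dpol k p).eval a = 0) (j : ℕ) : (upol k p j).eval a ≠ 0 := by
  have hZ : (Zpol k p).eval a ≠ 0 := by
    intro h
    simp only [Zpol, eval_add, eval_pow, eval_X] at h
    have e : a * (a ^ (p - 1) + 1) = 0 := by
      rw [mul_add, ← pow_succ', Nat.sub_add_cancel (by omega), mul_one]; exact h
    rcases mul_eq_zero.mp e with h | h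
    · rw [h, Dpol_eval_zero k p hp] at ha; exact hp1 ha
    · simp only [Dpol, eval_add, eval_mul, eval_natCast, eval_pow, eval_X, eval_sub, eval_one] at ha
      have : (1 : k) = 0 := by linear_combination (p : k) * h - ha
      exact one_ne_zero this
  have hu : (upol k p 0).eval a ≠ 0 := by
    rw [upol]; simp only [eval_mul, eval_sub, eval_natCast, eval_one]
    exact mul_ne_zero hp1 hZ
  have hP : ∀ j, (upol k p j).eval a ≠ 0 → (Ppol k p j).eval a ≠ 0 := by
    intro j h
    rcases Nat.eq_zero_or_pos j with rfl | hj
    · have : Ppol k p 0 = - Zpol k p := by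
        rw [Ppol, upol]; simp; ring
      rw [this, eval_neg]; exact neg_ne_zero.mpr hZ
    · have h1 : p ^ j - 1 ≠ 0 := by
        have := Nat.pow_le_pow_right (show 0 < p by omega) hj
        simp at this; omega
      simp only [Ppol, eval_sub, eval_mul, eval_pow, ha, zero_pow h1, mul_zero, sub_zero]
      exact h
  induction j with
  | zero => exact hu
  | succ j ih =>
    have h1 : p ^ (j + 1) ≠ 0 := by positivity
    rw [upol_succ k p (by omega)]
    simp only [eval_add, eval_mul, eval_pow, ha, zero_pow h1, mul_zero, add_zero]
    exact mul_ne_zero (pow_ne_zero _ ih) (hP j ih)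

lemma upol_periodic {k : Type*} [Field k] (p : ℕ) (hp : 3 ≤ p)
    (hp1 : (p : k) - 1 ≠ 0) (a : k) (ha : a ≠ 0) (j : ℕ) (hj : (upol k p j).eval a = 0)
    (i : ℕ) (hi : i < j) (hi0 : (upol k p i).eval a = 0) :
    ∃ m, 2 * (m + 2) ≤ j + 2 ∧ (upol k p m).eval a = 0 := by
  have hD : (Dpol k p).eval a ≠ 0 := fun h => upol_ne_of_D p hp hp1 a h j hj
  set A : k := -(p : k) * (Zpol k p).eval a / (Dpol k p).eval a with hA
  have hAD : A * (Dpol k p).eval a = -(p : k) * (Zpol k p).eval a := div_mul_cancel₀ _ hD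
  have hus : ∀ m, (polyIter (tri p A a) (m + 2)).eval 0 * (Dpol k p).eval a ^ (p ^ m) =
      (upol k p m).eval a := by
    intro m
    have := upol_spec p (by omega) (evalRingHom a) A (by simpa using hAD) m
    simpa using this
  have hiff : ∀ m, (upol k p m).eval a = 0 ↔ (polyIter (tri p A a) (m + 2)).eval 0 = 0 := by
    intro m
    rw [← hus, mul_eq_zero, or_iff_left (pow_ne_zero _ hD)]
  set f : k → k := fun x => (tri p A a).eval x with hf
  have hit : ∀ m x, (polyIter (tri p A a) m).eval x = f^[m] x := by
    intro m x
    induction m with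
    | zero => simp [polyIter]
    | succ m ih => rw [Function.iterate_succ_apply', polyIter, eval_comp, ih]
  have hper : ∀ m, (upol k p m).eval a = 0 ↔ Function.IsPeriodicPt f (m + 2) 0 := by
    intro m; rw [hiff, hit]; rfl
  set d := Function.minimalPeriod f 0 with hd
  have hdi : d ≤ i + 2 := ((hper i).mp hi0).minimalPeriod_le (by omega)
  have hdj : d ∣ j + 2 := ((hper j).mp hj).minimalPeriod_dvd
  have hd0 : 0 < d := ((hper i).mp hi0).minimalPeriod_pos (by omega)
  have hpd : Function.IsPeriodicPt f d 0 := Function.isPeriodicPt_minimalPeriod f 0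
  have hd1 : d ≠ 1 := by
    intro h1
    rw [h1] at hpd
    have h1 : p - 1 ≠ 0 := by omega
    have h0 : p ≠ 0 := by omega
    have : f 0 = a := by simp only [hf]; rw [tri_eval, zero_pow h0, zero_pow h1]; ring
    have h : f 0 = 0 := hpd
    exact ha (this.symm.trans h)
  refine ⟨d - 2, ?_, ?_⟩
  · obtain ⟨e, he⟩ := hdj
    have : 2 ≤ e := by
      by_contra h
      interval_cases e <;> omega
    have : d * 2 ≤ d * e := Nat.mul_le_mul_left _ this
    omega
  · rw [hper]
    have : d - 2 + 2 = d := by omega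
    rw [this]; exact hpd

open Classical in
/-- The simple roots of a polynomial. -/
noncomputable def simpleRoots {k : Type*} [Field k] (f : k[X]) : Finset k :=
  f.roots.toFinset.filter (fun a => (derivative f).eval a ≠ 0)

lemma mem_simpleRoots {k : Type*} [Field k] (f : k[X]) (hf : f ≠ 0) (a : k) :
    a ∈ simpleRoots f ↔ f.eval a = 0 ∧ (derivative f).eval a ≠ 0 := by
  classical
  simp [simpleRoots, hf]

/-- From many simple roots we get good places. -/
lemma exists_good {k : Type*} [Field k] (p : ℕ) (hp : 3 ≤ p)
    (hp1 : (p : k) - 1 ≠ 0) (M : ℕ) (hM : ∀ j, 2 ≤ j → p ^ j ≤ 2 * (simpleRoots (upol k p j)).card + M) :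
    ∃ N0, ∀ j, N0 ≤ j → ∃ a : k, a ≠ 0 ∧ (Dpol k p).eval a ≠ 0 ∧
      (∀ i < j, (upol k p i).eval a ≠ 0) ∧ (upol k p j).eval a = 0 ∧
      (derivative (upol k p j)).eval a ≠ 0 := by
  classical
  refine ⟨2 * (2 * p + M + 3), fun j hj => ?_⟩
  by_contra hno
  push Not at hno
  have hsub : simpleRoots (upol k p j) ⊆ insert 0 ((Finset.range (j / 2)).biUnion
      (fun i => (upol k p i).roots.toFinset)) := by
    intro a ha
    rw [mem_simpleRoots _ (upol_ne_zero p hp hp1 j)] at ha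
    by_cases ha0 : a = 0
    · simp [ha0]
    apply Finset.mem_insert_of_mem
    have hD : (Dpol k p).eval a ≠ 0 := fun h => upol_ne_of_D p hp hp1 a h j ha.1
    have : ∃ i < j, (upol k p i).eval a = 0 := by
      by_contra hcon
      push Not at hcon
      exact ha.2 (hno a ha0 hD hcon ha.1)
    obtain ⟨i, hi, hi0⟩ := this
    obtain ⟨m, hm, hm0⟩ := upol_periodic p hp hp1 a ha0 j ha.1 i hi hi0
    rw [Finset.mem_biUnion]
    refine ⟨m, Finset.mem_range.mpr (by omega), ?_⟩
    rw [Multiset.mem_toFinset, mem_roots (upol_ne_zero p hp hp1 m)]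
    exact hm0
  have hcard : (simpleRoots (upol k p j)).card ≤ p ^ (j / 2 + 1) + 1 := by
    refine le_trans (Finset.card_le_card hsub) (le_trans (Finset.card_insert_le _ _) ?_)
    apply Nat.add_le_add_right
    refine le_trans Finset.card_biUnion_le ?_
    have h1 : ∀ i ∈ Finset.range (j / 2), ((upol k p i).roots.toFinset).card ≤ p ^ (i + 1) := by
      intro i _
      refine le_trans (Multiset.toFinset_card_le _) (le_trans (card_roots' _) ?_)
      rw [(natDegree_upol_Ppol p hp hp1 i).1]
    refine le_trans (Finset.sum_le_sum h1) ?_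
    generalize j / 2 = s
    induction s with
    | zero => simp
    | succ s ih =>
      rw [Finset.sum_range_succ]
      have : p ^ (s + 1 + 1) = p ^ (s + 1) * p := pow_succ _ _
      nlinarith [Nat.pos_of_ne_zero (pow_ne_zero (s + 1) (show p ≠ 0 by omega))]
  have h := hM j (by omega)
  have h2 : p ^ (j / 2) * p ^ (j / 2) ≤ p ^ j := by
    rw [← pow_add]; exact Nat.pow_le_pow_right (by omega) (by omega)
  have h3 : j / 2 < p ^ (j / 2) := Nat.lt_pow_self (by omega)
  have h4 : 2 * p + M + 3 ≤ p ^ (j / 2) := by omega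
  have h5 : p ^ (j / 2 + 1) = p ^ (j / 2) * p := pow_succ _ _
  rw [h5] at hcard
  nlinarith [Nat.mul_le_mul_right (p ^ (j / 2)) h4]

lemma radical_natDegree_le {k : Type*} [Field k] [IsAlgClosed k] [DecidableEq k] (f : k[X])
    (S : Finset k) (hS : ∀ a, f.eval a = 0 → a ∈ S) :
    (UniqueFactorizationMonoid.radical f).natDegree ≤ S.card := by
  set r := UniqueFactorizationMonoid.radical f with hr
  have hrf : r ∣ f := UniqueFactorizationMonoid.radical_dvd_self
  have hsq : Squarefree r := UniqueFactorizationMonoid.squarefree_radical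
  have hsep : r.Separable := PerfectField.separable_iff_squarefree.mpr hsq
  have hnd := nodup_roots hsep
  rw [← IsAlgClosed.card_roots_eq_natDegree, ← Multiset.toFinset_card_of_nodup hnd]
  apply Finset.card_le_card
  intro a ha
  rw [Multiset.mem_toFinset] at ha
  apply hS
  obtain ⟨g, hg⟩ := hrf
  rw [hg, eval_mul, isRoot_of_mem_roots ha, zero_mul]

/-- Counting simple roots. -/
lemma simpleRoots_count {k : Type*} [Field k] [IsAlgClosed k] [DecidableEq k] (f : k[X]) (hf : f ≠ 0) :
    2 * f.roots.toFinset.card ≤ f.natDegree + (simpleRoots f).card := by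
  have h1 : ∀ a ∈ f.roots.toFinset, 2 ≤ f.roots.count a + (if a ∈ simpleRoots f then 1 else 0) := by
    intro a ha
    rw [Multiset.mem_toFinset] at ha
    have hr := isRoot_of_mem_roots ha
    split_ifs with h
    · have := Multiset.one_le_count_iff_mem.mpr ha; omega
    · rw [mem_simpleRoots f hf] at h
      push Not at h
      have := (one_lt_rootMultiplicity_iff_isRoot hf).mpr ⟨hr, h hr⟩
      rw [count_roots]; omega
  have h2 := Finset.sum_le_sum h1
  rw [Finset.sum_add_distrib, Multiset.toFinset_sum_count_eq, IsAlgClosed.card_roots_eq_natDegree,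
    Finset.sum_const, smul_eq_mul, Finset.sum_boole, Nat.cast_id] at h2
  have h3 : (f.roots.toFinset.filter (fun a => a ∈ simpleRoots f)).card ≤ (simpleRoots f).card := by
    apply Finset.card_le_card
    intro a ha
    exact (Finset.mem_filter.mp ha).2
  omega

lemma derivative_Dpow_ne {k : Type*} [Field k] (p : ℕ) (hp : 3 ≤ p) (hp0 : (p : k) ≠ 0)
    (hp1 : (p : k) - 1 ≠ 0) (j : ℕ) : derivative (Dpol k p ^ (p ^ j)) ≠ 0 := by
  have hD : Dpol k p ≠ 0 := by
    intro h
    have := Dpol_eval_zero k p hp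
    rw [h] at this; simp at this; exact hp1 this.symm
  rw [derivative_pow]
  apply mul_ne_zero (mul_ne_zero _ (pow_ne_zero _ hD))
  · have : derivative (Dpol k p) = C ((p : k) * ((p : k) - 1)) * X ^ (p - 2) := by
      rw [Dpol]
      have e : (((p - 1 : ℕ) : k) : k) = (p : k) - 1 := by
        rw [Nat.cast_sub (by omega)]; simp
      simp only [derivative_add, derivative_mul, derivative_sub, derivative_natCast, derivative_one,
        derivative_X_pow, e]
      have e2 : p - 1 - 1 = p - 2 := by omega
      rw [e2, C_mul, C_eq_natCast]; ring
    rw [this]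
    exact mul_ne_zero (C_ne_zero.mpr (mul_ne_zero hp0 hp1)) (pow_ne_zero _ X_ne_zero)
  · rw [C_ne_zero, Nat.cast_pow]; exact pow_ne_zero _ hp0

lemma count_ge5 {k : Type*} [Field k] [IsAlgClosed k] (p : ℕ) (hp : 5 ≤ p) (hp0 : (p : k) ≠ 0)
    (hp1 : (p : k) - 1 ≠ 0) : ∃ M, ∀ j, 2 ≤ j → p ^ j ≤ 2 * (simpleRoots (upol k p j)).card + M := by
  classical
  refine ⟨2 * p, fun j hj => ?_⟩
  obtain ⟨j, rfl⟩ := Nat.exists_eq_add_of_le' (show 1 ≤ j by omega)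
  have hp3 : 3 ≤ p := by omega
  have hp1' : p - 1 ≠ 0 := by omega
  have hp0' : p ≠ 0 := by omega
  obtain ⟨hdu, hdP⟩ := natDegree_upol_Ppol p hp3 hp1 j
  obtain ⟨hdu', _⟩ := natDegree_upol_Ppol p hp3 hp1 (j + 1)
  have hpos : 0 < p ^ (j + 1) := by positivity
  have hu := upol_ne_zero p hp3 hp1 j
  have hu' := upol_ne_zero p hp3 hp1 (j + 1)
  have hP0 : (Ppol k p j).eval 0 = 0 := by
    simp [Ppol, upol_eval_zero p hp3, Zpol, hp0']
  have hP : Ppol k p j ≠ 0 := by intro h; rw [h] at hdP; simp at hdP; omega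
  obtain ⟨P1, hP1⟩ := X_dvd_iff.mpr (by rw [coeff_zero_eq_eval_zero]; exact hP0 : (Ppol k p j).coeff 0 = 0)
  have hP1ne : P1 ≠ 0 := by rintro rfl; simp at hP1; exact hP hP1
  have hP1d : P1.natDegree + 1 = p ^ (j + 1) := by
    rw [← hdP, hP1, natDegree_X_mul hP1ne]
  set m := upol k p j ^ (p - 1) * P1 + Dpol k p ^ (p ^ (j + 1)) with hm
  have hum : upol k p (j + 1) = X * m := by
    rw [upol_succ k p (by omega), hP1, hm]; ring
  have hmne : m ≠ 0 := by intro h; rw [h, mul_zero] at hum; exact hu' hum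
  have hmd : m.natDegree + 1 = p ^ (j + 1 + 1) := by
    rw [← hdu', hum, natDegree_X_mul hmne]
  have hD : Dpol k p ≠ 0 := by
    intro h
    have := Dpol_eval_zero k p hp3
    rw [h] at this; simp at this; exact hp1 this.symm
  have hcop : IsCoprime (-m) (Dpol k p ^ (p ^ (j + 1))) := by
    apply IsCoprime.neg_left
    apply IsCoprime.pow_right
    rw [isCoprime_iff_aeval_ne_zero_of_isAlgClosed k k]
    intro a
    by_contra h
    push Not at h
    simp only [coe_aeval_eq_eval] at h
    apply upol_ne_of_D p hp3 hp1 a h.2 (j + 1)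
    rw [hum, eval_mul, h.1, mul_zero]
  have habc := Polynomial.abc (neg_ne_zero.mpr hmne) (pow_ne_zero (p ^ (j + 1)) hD)
    (mul_ne_zero (pow_ne_zero (p - 1) hu) hP1ne) hcop (by rw [hm]; ring)
  rcases habc with h | h
  · have h1 := h.1
    have hS : ∀ a, (-m * Dpol k p ^ p ^ (j + 1) * (upol k p j ^ (p - 1) * P1)).eval a = 0 → a ∈
      (m.roots.toFinset ∪ ((Dpol k p).roots.toFinset ∪ ((upol k p j).roots.toFinset ∪ P1.roots.toFinset))) := by
      intro a ha
      have ha' : m.eval a = 0 ∨ (Dpol k p).eval a = 0 ∨ (upol k p j).eval a = 0 ∨ P1.eval a = 0 := by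
        rw [eval_mul, eval_mul, eval_mul, eval_neg, eval_pow, eval_pow] at ha
        rcases mul_eq_zero.mp ha with ha | ha <;> rcases mul_eq_zero.mp ha with ha | ha
        · left; exact neg_eq_zero.mp ha
        · right; left; exact eq_zero_of_pow_eq_zero ha
        · right; right; left; exact eq_zero_of_pow_eq_zero ha
        · right; right; right; exact ha
      rw [Finset.mem_union, Finset.mem_union, Finset.mem_union, Multiset.mem_toFinset,
        Multiset.mem_toFinset, Multiset.mem_toFinset, Multiset.mem_toFinset, mem_roots hmne,
        mem_roots hD, mem_roots hu, mem_roots hP1ne]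
      exact ha'
    have hrad := radical_natDegree_le _ _ hS
    have hc : ∀ f : k[X], f.roots.toFinset.card ≤ f.natDegree := fun f =>
      le_trans (Multiset.toFinset_card_le _) (card_roots' _)
    have hcard : (m.roots.toFinset ∪ ((Dpol k p).roots.toFinset ∪ ((upol k p j).roots.toFinset ∪ P1.roots.toFinset))).card
        ≤ m.roots.toFinset.card + ((p - 1) + (p ^ (j + 1) + P1.natDegree)) := by
      refine le_trans (Finset.card_union_le _ _) (Nat.add_le_add_left ?_ _)
      refine le_trans (Finset.card_union_le _ _) (Nat.add_le_add (le_trans (hc _) (natDegree_Dpol_le k p)) ?_)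
      refine le_trans (Finset.card_union_le _ _) (Nat.add_le_add (hdu ▸ hc _) (hc _))
    rw [natDegree_neg] at h1
    have hsimple : (simpleRoots m).card ≤ (simpleRoots (upol k p (j + 1))).card := by
      apply Finset.card_le_card
      intro a ha
      rw [mem_simpleRoots m hmne] at ha
      rw [mem_simpleRoots _ hu', hum]
      have ha0 : a ≠ 0 := by
        rintro rfl
        have := ha.1
        rw [hm] at this
        simp only [eval_add, eval_mul, eval_pow, upol_eval_zero p hp3, Dpol_eval_zero k p hp3,
          zero_pow hp1', zero_mul, zero_add] at this
        exact pow_ne_zero _ hp1 this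
      simp only [eval_mul, derivative_mul, eval_add, ha.1, mul_zero, derivative_X, eval_X, zero_add, true_and]
      exact mul_ne_zero ha0 ha.2
    have hcnt := simpleRoots_count m hmne
    have hpp : p ^ (j + 1 + 1) = p ^ (j + 1) * p := pow_succ _ _
    have h5 : p ^ (j + 1) * 5 ≤ p ^ (j + 1) * p := Nat.mul_le_mul_left _ hp
    omega
  · exact absurd h.2.1 (derivative_Dpow_ne p hp3 hp0 hp1 (j + 1))

lemma Dpol_three (k : Type*) [Field k] : Dpol k 3 = 3 * X ^ 2 + 2 := by
  rw [Dpol]; push_cast; ring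

lemma Zpol_three (k : Type*) [Field k] : Zpol k 3 = X ^ 3 + X := rfl

/-- split off the simple roots. -/
lemma split_simple {k : Type*} [Field k] [IsAlgClosed k] (W : k[X]) (hW : W ≠ 0) :
    ∃ E F : k[X], E ≠ 0 ∧ F ≠ 0 ∧ W = E * F ∧ F ∣ (derivative F) ^ 2 ∧
      E.natDegree = (simpleRoots W).card := by
  classical
  set E : k[X] := ((simpleRoots W).val.map (fun a => X - C a)).prod with hE
  have hdvd : E ∣ W := by
    rw [hE, Multiset.prod_X_sub_C_dvd_iff_le_roots hW, Multiset.le_iff_subset (simpleRoots W).nodup]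
    intro a ha
    have := (mem_simpleRoots W hW a).mp ha
    exact (mem_roots hW).mpr this.1
  obtain ⟨F, hF⟩ := hdvd
  have hEne : E ≠ 0 := by rintro h; rw [h, zero_mul] at hF; exact hW hF
  have hFne : F ≠ 0 := by rintro h; rw [h, mul_zero] at hF; exact hW hF
  have hEr : E.roots = (simpleRoots W).val := roots_multiset_prod_X_sub_C _
  refine ⟨E, F, hEne, hFne, hF, ?_, natDegree_multiset_prod_X_sub_C_eq_card _⟩
  apply dvd_derivative_sq F hFne
  intro a ha
  have hcount : W.roots.count a = (simpleRoots W).val.count a + F.roots.count a := by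
    conv_lhs => rw [hF]
    rw [roots_mul (hF ▸ hW), hEr, Multiset.count_add]
  have hFa : 1 ≤ F.roots.count a := Multiset.one_le_count_iff_mem.mpr ((mem_roots hFne).mpr ha)
  have hWa : W.eval a = 0 := by rw [hF, eval_mul, show F.eval a = 0 from ha, mul_zero]
  by_cases hs : a ∈ simpleRoots W
  · exfalso
    have h1 : 1 ≤ (simpleRoots W).val.count a := Multiset.one_le_count_iff_mem.mpr hs
    have h2 : 1 < W.rootMultiplicity a := by rw [← count_roots]; omega
    have h3 := ((one_lt_rootMultiplicity_iff_isRoot hW).mp h2).2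
    exact ((mem_simpleRoots W hW a).mp hs).2 h3
  · have h0 : (simpleRoots W).val.count a = 0 := Multiset.count_eq_zero_of_notMem hs
    have hd : (derivative W).eval a = 0 := by
      by_contra hd
      exact hs ((mem_simpleRoots W hW a).mpr ⟨hWa, hd⟩)
    have h2 := (one_lt_rootMultiplicity_iff_isRoot hW).mpr ⟨hWa, hd⟩
    rw [← count_roots] at h2 ⊢
    omega

lemma phi_no_root {k : Type*} [Field k] (p : ℕ) (hp3 : 3 ≤ p) (hp1 : (p : k) - 1 ≠ 0) (x : RatFunc k) :
    (phiK k p).eval x ≠ 0 := by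
  intro h
  have h1 := f_irreducible (k := k) p hp3 hp1 1 le_rfl
  have h2 : polyIter (phiK k p) 1 = phiK k p := by simp [polyIter]
  rw [h2] at h1
  have h3 := degree_eq_one_of_irreducible_of_root h1 h
  have h4 : (phiK k p).natDegree = p := tri_natDegree p (by omega) _ _
  have h5 : (phiK k p).natDegree = 1 := natDegree_eq_of_degree_eq_some h3
  omega

lemma no_root_three {k : Type*} [Field k] (h2 : (2 : k) ≠ 0) (y z : k[X]) (hz : z ≠ 0)
    (hD : Dpol k 3 ≠ 0) :
    Dpol k 3 ^ 3 * y ^ 3 - 3 * Zpol k 3 ^ 2 * Dpol k 3 * y * z ^ 2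
      + (X * Dpol k 3 ^ 3 - 2 * Zpol k 3 ^ 3) * z ^ 3 ≠ 0 := by
  intro h
  have hp1 : ((3 : ℕ) : k) - 1 ≠ 0 := by
    have : ((3 : ℕ) : k) - 1 = 2 := by push_cast; ring
    rw [this]; exact h2
  have hinj : Function.Injective (algebraMap k[X] (RatFunc k)) := IsFractionRing.injective _ _
  set D := algebraMap k[X] (RatFunc k) (Dpol k 3) with hDd
  set Z := algebraMap k[X] (RatFunc k) (Zpol k 3) with hZd
  set y' := algebraMap k[X] (RatFunc k) y
  set z' := algebraMap k[X] (RatFunc k) z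
  set t := algebraMap k[X] (RatFunc k) X with ht
  have hD' : D ≠ 0 := by rw [hDd, Ne, map_eq_zero_iff _ hinj]; exact hD
  have hz' : z' ≠ 0 := by rw [Ne, map_eq_zero_iff _ hinj]; exact hz
  apply phi_no_root 3 le_rfl hp1 ((D * y' + Z * z') / (D * z'))
  have h' : D ^ 3 * y' ^ 3 - 3 * Z ^ 2 * D * y' * z' ^ 2 + (t * D ^ 3 - 2 * Z ^ 3) * z' ^ 3 = 0 := by
    have := congrArg (algebraMap k[X] (RatFunc k)) h
    simpa only [map_add, map_sub, map_mul, map_pow, map_zero, map_ofNat] using this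
  rw [phiK, tri_eval, AK, ← hDd, ← hZd, ← ht]
  have e : (3 - 1 : ℕ) = 2 := rfl
  rw [e]
  field_simp
  push_cast
  linear_combination h'

lemma three_const {k : Type*} [Field k] [IsAlgClosed k] (h2 : (2 : k) ≠ 0) (h3 : (3 : k) ≠ 0) :
    ∃ M, ∀ j, 2 ≤ j → 3 ^ j ≤ 2 * (simpleRoots (upol k 3 j)).card + M := by
  have hp1 : ((3 : ℕ) : k) - 1 ≠ 0 := by
    have : ((3 : ℕ) : k) - 1 = 2 := by push_cast; ring
    rw [this]; exact h2
  have hDne : Dpol k 3 ≠ 0 := by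
    intro h
    have := Dpol_eval_zero k 3 le_rfl
    rw [h] at this; simp only [eval_zero] at this; exact hp1 this.symm
  have hD := Dpol_three k
  have hZ := Zpol_three k
  set D := Dpol k 3 with hDd
  set Z := Zpol k 3 with hZd
  have hC2 : (2 : k[X]) ≠ 0 := by
    rw [← map_ofNat C 2, C_ne_zero]; exact h2
  have hC3 : (3 : k[X]) ≠ 0 := by
    rw [← map_ofNat C 3, C_ne_zero]; exact h3
  have h18 : (18 : k[X]) ≠ 0 := by
    have : (18 : k[X]) = 2 * 3 ^ 2 := by norm_num
    rw [this]; exact mul_ne_zero hC2 (pow_ne_zero _ hC3)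
  obtain ⟨N1, hN1⟩ : ∃ N1 : k[X], N1 = D ^ 3 - 4 * X ^ 2 * (X ^ 2 + 1) ^ 3 := ⟨_, rfl⟩
  have hN1ne : N1 ≠ 0 := by
    intro h
    have := congrArg (eval 0) hN1
    rw [h, hD] at this
    simp at this
    exact pow_ne_zero 3 h2 this.symm
  have hXne : (X : k[X]) ≠ 0 := X_ne_zero
  have hc2 : C (2 : k) = 2 := map_ofNat C 2
  have hc3 : C (3 : k) = 3 := map_ofNat C 3
  have hnr : ∀ y z : k[X], z ≠ 0 → (18 * X * N1 * D ^ 3) * y ^ 3 + 3 * (-18 * Z ^ 2 * D * X * N1) * y * z ^ 2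
      + (18 * (X * D ^ 3 - 2 * Z ^ 3) * X * N1) * z ^ 3 ≠ 0 := by
    intro y z hz h
    have h1 := no_root_three h2 y z hz hDne
    rw [← hDd, ← hZd] at h1
    have e : (18 * X * N1 * D ^ 3) * y ^ 3 + 3 * (-18 * Z ^ 2 * D * X * N1) * y * z ^ 2
      + (18 * (X * D ^ 3 - 2 * Z ^ 3) * X * N1) * z ^ 3 = (18 * X * N1) * (D ^ 3 * y ^ 3 - 3 * Z ^ 2 * D * y * z ^ 2
      + (X * D ^ 3 - 2 * Z ^ 3) * z ^ 3) := by ring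
    rw [e] at h
    exact mul_ne_zero (mul_ne_zero (mul_ne_zero h18 hXne) hN1ne) h1 h
  have hdD : derivative D = 6 * X := by
    rw [hD]; simp [derivative_mul, hc2, hc3]; ring
  have hdZ : derivative Z = 3 * X ^ 2 + 1 := by
    rw [hZ]; simp only [derivative_add, derivative_X_pow, derivative_X]; push_cast; rw [hc3]
  have hdN : derivative N1 = 18 * X * D ^ 2 - 8 * X * (X ^ 2 + 1) ^ 3 - 24 * X ^ 3 * (X ^ 2 + 1) ^ 2 := by
    rw [hN1]; simp [derivative_mul, derivative_pow, hdD, hc2, hc3]; ring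
  have hT : (18 * X * N1 * D ^ 3 : k[X]) ≠ 0 :=
    mul_ne_zero (mul_ne_zero (mul_ne_zero h18 hXne) hN1ne) (pow_ne_zero _ hDne)
  obtain ⟨r10, hr10⟩ : ∃ r10 : k[X], r10 = 3 * (2 * N1 * D ^ 3 + X * derivative N1 * D ^ 3 - 18 * X ^ 2 * N1 * D ^ 2) := ⟨_, rfl⟩
  obtain ⟨r, hr⟩ : ∃ r : k[X], r = -24 * (X ^ 2 + 1) * (3 * X ^ 4 + 2 * X ^ 2 + 2) * X * D ^ 3 := ⟨_, rfl⟩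
  have hrne : r ≠ 0 := by
    have e24 : (-24 : k[X]) ≠ 0 := by
      have : (-24 : k[X]) = -(2 ^ 3 * 3) := by norm_num
      rw [this]; exact neg_ne_zero.mpr (mul_ne_zero (pow_ne_zero _ hC2) hC3)
    have e1 : (X ^ 2 + 1 : k[X]) ≠ 0 := by
      intro h; have := congrArg (eval 0) h; simp at this
    have e2 : (3 * X ^ 4 + 2 * X ^ 2 + 2 : k[X]) ≠ 0 := by
      intro h; have := congrArg (eval 0) h; simp at this; exact h2 this
    rw [hr]
    exact mul_ne_zero (mul_ne_zero (mul_ne_zero (mul_ne_zero e24 e1) e2) hXne) (pow_ne_zero _ hDne)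
  have hΔ : (27 : k[X]) * (4 * (-18 * Z ^ 2 * D * X * N1) ^ 3 + (18 * X * N1 * D ^ 3) * (18 * (X * D ^ 3 - 2 * Z ^ 3) * X * N1) ^ 2) ≠ 0 := by
    have e : (27 : k[X]) * (4 * (-18 * Z ^ 2 * D * X * N1) ^ 3 + (18 * X * N1 * D ^ 3) * (18 * (X * D ^ 3 - 2 * Z ^ 3) * X * N1) ^ 2)
        = 3 ^ 3 * 18 ^ 3 * X ^ 5 * N1 ^ 4 * D ^ 6 := by
      have : X * D ^ 3 - 4 * Z ^ 3 = X * N1 := by rw [hN1, hZ]; ring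
      linear_combination (27 * 18 ^ 3 * X ^ 4 * N1 ^ 3 * D ^ 6) * this
    rw [e]
    exact mul_ne_zero (mul_ne_zero (mul_ne_zero (mul_ne_zero (pow_ne_zero _ hC3) (pow_ne_zero _ h18))
      (pow_ne_zero _ hXne)) (pow_ne_zero _ hN1ne)) (pow_ne_zero _ hDne)
  have hode1 : derivative (-18 * Z ^ 2 * D * X * N1) * (18 * X * N1 * D ^ 3)
      - (-18 * Z ^ 2 * D * X * N1) * derivative (18 * X * N1 * D ^ 3)
      = (18 * (X * D ^ 3 - 2 * Z ^ 3) * X * N1) * r + 2 * (-18 * Z ^ 2 * D * X * N1) * r10 := by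
    have e1 : derivative (-18 * Z ^ 2 * D * X * N1) = -36 * Z * derivative Z * D * X * N1
      - 18 * Z ^ 2 * derivative D * X * N1 - 18 * Z ^ 2 * D * N1 - 18 * Z ^ 2 * D * X * derivative N1 := by
      simp [derivative_mul, derivative_pow, hc2, hc3]; ring
    have e2 : derivative (18 * X * N1 * D ^ 3) = 18 * N1 * D ^ 3 + 18 * X * derivative N1 * D ^ 3
      + 54 * X * N1 * D ^ 2 * derivative D := by
      simp [derivative_mul, derivative_pow, hc2, hc3]; ring
    rw [e1, e2, hr, hr10, hdN, hdD, hdZ, hN1, hD, hZ]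
    ring
  have hode2 : (18 * X * N1 * D ^ 3) * (derivative (18 * (X * D ^ 3 - 2 * Z ^ 3) * X * N1) * (18 * X * N1 * D ^ 3)
      - (18 * (X * D ^ 3 - 2 * Z ^ 3) * X * N1) * derivative (18 * X * N1 * D ^ 3))
      = 3 * (18 * X * N1 * D ^ 3) * (18 * (X * D ^ 3 - 2 * Z ^ 3) * X * N1) * r10 - 6 * (-18 * Z ^ 2 * D * X * N1) ^ 2 * r := by
    have e1 : derivative (18 * (X * D ^ 3 - 2 * Z ^ 3) * X * N1) =
      18 * (D ^ 3 + 3 * X * D ^ 2 * derivative D - 6 * Z ^ 2 * derivative Z) * X * N1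
      + 18 * (X * D ^ 3 - 2 * Z ^ 3) * N1 + 18 * (X * D ^ 3 - 2 * Z ^ 3) * X * derivative N1 := by
      simp [derivative_mul, derivative_pow, hc2, hc3]; ring
    have e2 : derivative (18 * X * N1 * D ^ 3) = 18 * N1 * D ^ 3 + 18 * X * derivative N1 * D ^ 3
      + 54 * X * N1 * D ^ 2 * derivative D := by
      simp [derivative_mul, derivative_pow, hc2, hc3]; ring
    rw [e1, e2, hr, hr10, hdN, hdD, hdZ, hN1, hD, hZ]
    ring
  obtain ⟨M, hM⟩ := siegel_bound _ _ _ r10 r hT hrne h2 hΔ hode1 hode2 hnr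
  refine ⟨M, fun j hj => ?_⟩
  obtain ⟨j, rfl⟩ := Nat.exists_eq_add_of_le' (show 1 ≤ j by omega)
  have hj1 : 1 ≤ j := by omega
  obtain ⟨E, F, hE, hF, hWEF, hFF, hEd⟩ := split_simple (upol k 3 (j + 1)) (upol_ne_zero 3 le_rfl hp1 (j + 1))
  have he : 3 ≤ 3 ^ j := by
    calc 3 = 3 ^ 1 := rfl
      _ ≤ 3 ^ j := Nat.pow_le_pow_right (by norm_num) hj1
  obtain ⟨hdu, _⟩ := natDegree_upol_Ppol (k := k) 3 le_rfl hp1 j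
  obtain ⟨hdu', _⟩ := natDegree_upol_Ppol (k := k) 3 le_rfl hp1 (j + 1)
  have hPd : (upol k 3 j - Z * D ^ (3 ^ j - 1)).natDegree = 3 ^ (j + 1) := by
    rw [natDegree_sub_eq_left_of_natDegree_lt, hdu]
    rw [hdu]
    have := natDegree_ZD_lt (k := k) 3 le_rfl j hj1 1 natDegree_one
    rwa [one_mul] at this
  have hVD : D ^ (3 ^ j) = D * D ^ (3 ^ j - 1) := by rw [← pow_succ']; congr 1; omega
  have hDd2 : D.natDegree ≤ 2 := natDegree_Dpol_le k 3
  rw [← hEd, ← hPd]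
  apply hM (upol k 3 j - Z * D ^ (3 ^ j - 1)) (D ^ (3 ^ j)) (upol k 3 (j + 1))
    ((18 * X * N1 * D ^ 3) * derivative (upol k 3 j - Z * D ^ (3 ^ j - 1))
      - ((3 ^ j : ℕ) : k[X]) * ((18 * X * N1 * D ^ 2) * derivative D * (upol k 3 j - Z * D ^ (3 ^ j - 1)))
      - r10 * (upol k 3 j - Z * D ^ (3 ^ j - 1))) E F (pow_ne_zero _ hDne) hF hE
  · apply IsCoprime.pow_right
    rw [isCoprime_iff_aeval_ne_zero_of_isAlgClosed k k]
    intro a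
    by_contra h
    push Not at h
    simp only [coe_aeval_eq_eval] at h
    apply upol_ne_of_D 3 le_rfl hp1 a h.2 j
    have h1 := h.1
    have hne : 3 ^ j - 1 ≠ 0 := by omega
    rwa [eval_sub, eval_mul, eval_pow, h.2, zero_pow hne, mul_zero, sub_zero] at h1
  · apply IsCoprime.pow_right
    rw [isCoprime_iff_aeval_ne_zero_of_isAlgClosed k k]
    intro a
    by_contra h
    push Not at h
    simp only [coe_aeval_eq_eval] at h
    exact upol_ne_of_D 3 le_rfl hp1 a h.2 (j + 1) h.1
  · have e1 : D ^ 3 ^ (j + 1) = (D * D ^ (3 ^ j - 1)) ^ 3 := by rw [← hVD, ← pow_mul, pow_succ]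
    rw [upol, ← hDd, ← hZd, e1, hVD]
    generalize D ^ (3 ^ j - 1) = d
    have e : (3 - 1 : ℕ) = 2 := rfl
    rw [e]
    push_cast
    ring
  · rw [derivative_pow, C_eq_natCast, hVD]
    generalize D ^ (3 ^ j - 1) = d
    ring
  · exact hWEF
  · exact hFF
  · rw [hPd]
    refine le_trans (natDegree_pow_le_of_le _ hDd2) ?_
    rw [pow_succ]; omega
  · generalize upol k 3 j - Z * D ^ (3 ^ j - 1) = P
    have hTd : (18 * X * N1 * D ^ 3 : k[X]).natDegree = (18 * X * N1 * D ^ 2 : k[X]).natDegree + D.natDegree := by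
      rw [← natDegree_mul]
      · congr 1; ring
      · exact mul_ne_zero (mul_ne_zero (mul_ne_zero h18 hXne) hN1ne) (pow_ne_zero _ hDne)
      · exact hDne
    refine natDegree_sub_le_of_le (natDegree_sub_le_of_le ?_ ?_ |>.trans (max_self _).le) ?_ |>.trans (max_self _).le
    · refine le_trans (natDegree_mul_le) ?_
      have := natDegree_derivative_le P
      omega
    · refine le_trans natDegree_mul_le ?_
      rw [natDegree_natCast]
      refine le_trans (Nat.add_le_add_left (natDegree_mul_le_of_le natDegree_mul_le le_rfl) _) ?_
      have := natDegree_derivative_le D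
      omega
    · refine le_trans natDegree_mul_le ?_
      omega
  · rw [hdu', hPd, pow_succ]; ring

lemma splitting_baseChange_le (F F' L L' : Type*) [Field F] [Field F'] [Field L] [Field L']
    [Algebra F F'] [Algebra F L] [Algebra F' L'] [Algebra F L'] [IsScalarTower F F' L']
    (q : F[X]) [IsSplittingField F L q] [IsSplittingField F' L' (q.map (algebraMap F F'))] :
    Module.finrank F' L' ≤ Module.finrank F L := by
  have hfin : FiniteDimensional F L := IsSplittingField.finiteDimensional L q
  have hs : (q.map (algebraMap F L')).Splits := by
    have := IsSplittingField.splits L' (q.map (algebraMap F F'))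
    rwa [Polynomial.map_map, ← IsScalarTower.algebraMap_eq] at this
  let σ : L →ₐ[F] L' := IsSplittingField.lift L q hs
  let T : TensorProduct F F' L →ₐ[F'] L' := Algebra.TensorProduct.productLeftAlgHom (Algebra.ofId F' L') σ
  have hT : Function.Surjective T := by
    rw [← AlgHom.range_eq_top, eq_top_iff, ← IsSplittingField.adjoin_rootSet L' (q.map (algebraMap F F'))]
    rw [Algebra.adjoin_le_iff]
    intro x hx
    have hx' : x ∈ q.rootSet L' := by
      rw [mem_rootSet'] at hx ⊢
      rwa [Polynomial.map_map, ← IsScalarTower.algebraMap_eq, aeval_map_algebraMap] at hx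
    rw [← (IsSplittingField.splits L q).image_rootSet σ] at hx'
    obtain ⟨y, -, rfl⟩ := hx'
    exact ⟨1 ⊗ₜ[F] y, by simp [T]⟩
  rw [← Module.finrank_baseChange (R := F') (M' := L) (S := F)]
  exact LinearMap.finrank_le_finrank_of_surjective (f := T.toLinearMap) hT

lemma splitting_descent_le (F F' L L' : Type*) [Field F] [Field F'] [Field L] [Field L']
    [Algebra F F'] [Algebra F L] [Algebra F' L'] [Algebra F L'] [IsScalarTower F F' L']
    [FiniteDimensional F F']
    (q : F[X]) [IsSplittingField F L q] [IsSplittingField F' L' (q.map (algebraMap F F'))] :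
    Module.finrank F L ≤ Module.finrank F F' * Module.finrank F' L' := by
  have hfin : FiniteDimensional F' L' := IsSplittingField.finiteDimensional L' (q.map (algebraMap F F'))
  have hfin2 : FiniteDimensional F L' := Module.Finite.trans F' L'
  have hs : (q.map (algebraMap F L')).Splits := by
    have := IsSplittingField.splits L' (q.map (algebraMap F F'))
    rwa [Polynomial.map_map, ← IsScalarTower.algebraMap_eq] at this
  let σ : L →ₐ[F] L' := IsSplittingField.lift L q hs
  rw [Module.finrank_mul_finrank]
  exact LinearMap.finrank_le_finrank_of_injective (f := σ.toLinearMap) σ.injective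

lemma splitting_map_le {F F' : Type*} [Field F] [Field F'] (ι : F →+* F') (q : F[X]) :
    Module.finrank F' (q.map ι).SplittingField ≤ Module.finrank F q.SplittingField := by
  let _ : Algebra F F' := ι.toAlgebra
  have : IsSplittingField F' (q.map ι).SplittingField (q.map (algebraMap F F')) :=
    inferInstanceAs (IsSplittingField F' (q.map ι).SplittingField (q.map ι))
  exact splitting_baseChange_le F F' q.SplittingField (q.map ι).SplittingField q

lemma splitting_le_mul {F F' : Type*} [Field F] [Field F'] (ι : F →+* F') (hι : ι.Finite) :
    ∃ m : ℕ, ∀ q : F[X], Module.finrank F q.SplittingField ≤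
      m * Module.finrank F' (q.map ι).SplittingField := by
  let _ : Algebra F F' := ι.toAlgebra
  have hf : FiniteDimensional F F' := hι
  refine ⟨Module.finrank F F', fun q => ?_⟩
  have : IsSplittingField F' (q.map ι).SplittingField (q.map (algebraMap F F')) :=
    inferInstanceAs (IsSplittingField F' (q.map ι).SplittingField (q.map ι))
  exact splitting_descent_le F F' q.SplittingField (q.map ι).SplittingField q

lemma exists_subst {k : Type*} [Field k] (B : RatFunc k)
    (hB : B ∉ Set.range (⇑(RatFunc.C : k →+* RatFunc k))) :
    ∃ ι : RatFunc k →+* RatFunc k, ι.Finite ∧ ∀ f : k[X], ι (algebraMap k[X] (RatFunc k) f) = aeval B f := by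
  have hB' : ¬ ∃ c, B = RatFunc.C c := by
    rintro ⟨c, hc⟩; exact hB ⟨c, hc.symm⟩
  have htr := B.transcendental_of_ne_C hB'
  have hinj : Function.Injective (aeval B : k[X] →ₐ[k] RatFunc k).toRingHom :=
    transcendental_iff_injective.mp htr
  let ι : RatFunc k →+* RatFunc k := IsFractionRing.lift hinj
  have hι : ∀ f : k[X], ι (algebraMap k[X] (RatFunc k) f) = aeval B f :=
    fun f => IsFractionRing.lift_algebraMap hinj f
  refine ⟨ι, ?_, hι⟩
  have hpos : 0 < Module.finrank (IntermediateField.adjoin k {B}) (RatFunc k) := by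
    rw [RatFunc.finrank_eq_max_natDegree]
    by_contra h
    have h1 : B.num.natDegree = 0 := by omega
    have h2 : B.denom.natDegree = 0 := by omega
    apply hB'
    rw [natDegree_eq_zero] at h1 h2
    obtain ⟨a, ha⟩ := h1
    obtain ⟨b, hb⟩ := h2
    refine ⟨a / b, ?_⟩
    conv_lhs => rw [← RatFunc.num_div_denom B]
    rw [← ha, ← hb]; simp
  have hfd : Module.Finite (IntermediateField.adjoin k {B}) (RatFunc k) :=
    Module.finite_of_finrank_pos hpos
  have hmem : ∀ x, ι x ∈ IntermediateField.adjoin k {B} := by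
    intro x
    rw [IntermediateField.mem_adjoin_simple_iff]
    refine ⟨x.num, x.denom, ?_⟩
    conv_lhs => rw [← RatFunc.num_div_denom x]
    rw [map_div₀, hι, hι]
  let ι' : RatFunc k →+* IntermediateField.adjoin k {B} := ι.codRestrict _ hmem
  have hs : Function.Surjective ι' := by
    rintro ⟨y, hy⟩
    obtain ⟨r, s, h⟩ := (IntermediateField.mem_adjoin_simple_iff _ _).mp hy
    refine ⟨algebraMap _ _ r / algebraMap _ _ s, Subtype.ext ?_⟩
    change ι _ = y
    rw [map_div₀, hι, hι, h]
  have hc : ι = (algebraMap (IntermediateField.adjoin k {B}) (RatFunc k)).comp ι' := rfl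
  rw [hc]
  exact RingHom.Finite.comp (RingHom.finite_algebraMap.mpr hfd) (RingHom.Finite.of_surjective _ hs)

lemma algclosed_case {k : Type*} [Field k] [IsAlgClosed k] (p : ℕ) (hp : p.Prime) (hp3 : 3 ≤ p)
    (hp0 : (p : k) ≠ 0) (hp1 : (p : k) - 1 ≠ 0) :
    ∃ N : ℕ, 1 ≤ N ∧ ∀ n : ℕ, p.factorial ^ (∑ i ∈ Finset.range n, p ^ i) ≤
      N * Module.finrank (RatFunc k) (polyIter (phiK k p) n).SplittingField := by
  have hodd : Odd p := hp.odd_of_ne_two (by omega)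
  have h2 : (2 : k) ≠ 0 := by
    intro h
    obtain ⟨m, hm⟩ := hodd
    apply hp1
    rw [hm]; push_cast; rw [h]; ring
  have hM : ∃ M, ∀ j, 2 ≤ j → p ^ j ≤ 2 * (simpleRoots (upol k p j)).card + M := by
    by_cases h3 : p = 3
    · subst h3
      exact three_const h2 (by exact_mod_cast hp0)
    · have h5 : 5 ≤ p := by
        obtain ⟨m, hm⟩ := hodd
        omega
      exact count_ge5 p h5 hp0 hp1
  obtain ⟨M, hM⟩ := hM
  obtain ⟨N0, hN0⟩ := exists_good p hp3 hp1 M hM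
  have hfac : 1 ≤ p.factorial := Nat.factorial_pos p
  refine ⟨p.factorial ^ (∑ i ∈ Finset.range N0, p ^ i), Nat.one_le_pow _ _ hfac, fun n => ?_⟩
  induction n with
  | zero =>
    have : 0 < Module.finrank (RatFunc k) (polyIter (phiK k p) 0).SplittingField := Module.finrank_pos
    rw [Finset.range_zero, Finset.sum_empty, pow_zero]
    exact Nat.mul_pos (Nat.one_le_pow _ _ hfac) this
  | succ n ih =>
    by_cases hn : n + 1 ≤ N0
    · have : 0 < Module.finrank (RatFunc k) (polyIter (phiK k p) (n + 1)).SplittingField :=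
        Module.finrank_pos
      refine le_trans (Nat.pow_le_pow_right hfac ?_) (Nat.le_mul_of_pos_right _ this)
      exact Finset.sum_le_sum_of_subset (Finset.range_mono hn)
    · obtain ⟨a, ha, hD, hu, hu0, hu1⟩ := hN0 (n + 1) (by omega)
      have hstep := step_ineq p hp hp3 hp0 hp1 h2 n a ha hD hu hu0 hu1
      rw [Finset.sum_range_succ, pow_add, mul_comm]
      refine le_trans (Nat.mul_le_mul_left _ ih) ?_
      rw [mul_left_comm]
      exact Nat.mul_le_mul_left _ hstep

lemma phiK_map_closure {k k' : Type*} [Field k] [Field k'] (f : k →+* k') (p : ℕ) :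
    ∃ ι : RatFunc k →+* RatFunc k', (phiK k p).map ι = phiK k' p := by
  have hinj : Function.Injective ((algebraMap k'[X] (RatFunc k')).comp (mapRingHom f)) := by
    rw [RingHom.coe_comp]
    exact (IsFractionRing.injective _ _).comp (Polynomial.map_injective f f.injective)
  have hι : ∀ g : k[X], (IsFractionRing.lift hinj : RatFunc k →+* RatFunc k') (algebraMap k[X] (RatFunc k) g) =
      algebraMap k'[X] (RatFunc k') (g.map f) := fun g => IsFractionRing.lift_algebraMap hinj g
  refine ⟨IsFractionRing.lift hinj, ?_⟩
  rw [phiK, tri_map, hι, phiK, AK, AK, map_div₀, map_mul, hι, hι, map_neg, map_natCast]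
  simp [Zpol, Dpol]

lemma phiK_map_subst {k : Type*} [Field k] (p : ℕ) (B : RatFunc k) (ι : RatFunc k →+* RatFunc k)
    (hι : ∀ f : k[X], ι (algebraMap k[X] (RatFunc k) f) = aeval B f) :
    (phiK k p).map ι = X ^ p
              + C ((-(p : RatFunc k) * B ^ p - (p : RatFunc k) * B) /
                  ((p : RatFunc k) * B ^ (p - 1) + (p : RatFunc k) - 1)) * X ^ (p - 1)
              + C B := by
  rw [phiK, tri_map, hι, AK, map_div₀, map_mul, hι, hι, map_neg, map_natCast, tri, aeval_X]
  have h1 : -(p : RatFunc k) * aeval B (Zpol k p) = -(p : RatFunc k) * B ^ p - (p : RatFunc k) * B := by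
    simp [Zpol]; ring
  have h2 : aeval B (Dpol k p) = (p : RatFunc k) * B ^ (p - 1) + (p : RatFunc k) - 1 := by
    simp [Dpol]; ring
  rw [h1, h2]

/-- For `K = k(t)`, a prime `p ≥ 3` with `p(p-1) ≠ 0` in `k`, and non-constant
`B ∈ k(t)`, the trinomial `φ_{p,B} = x^p + ((-pB^p - pB)/(pB^{p-1} + p - 1)) x^{p-1} + B`
has arboreal representation of finite index in `Aut(T_p)`: the indices at each level `n` are
bounded, i.e. there is `C ≥ 1` with `(p!)^{1+p+⋯+p^{n-1}} ≤ C · [K_n : K]` for all `n ≥ 1`. -/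
theorem stmt_8 (k : Type*) [Field k] (p : ℕ) (hp : p.Prime) (hp3 : 3 ≤ p)
    (hpk : ((p * (p - 1) : ℕ) : k) ≠ 0)
    (B : RatFunc k) (hB : B ∉ Set.range (⇑(RatFunc.C : k →+* RatFunc k)))
    (hden : (p : RatFunc k) * B ^ (p - 1) + ((p : RatFunc k) - 1) ≠ 0) :
    ∃ N : ℕ, 1 ≤ N ∧ ∀ n : ℕ, 1 ≤ n →
      (Nat.factorial p) ^ (∑ i ∈ Finset.range n, p ^ i) ≤
        N * Module.finrank (RatFunc k)
          ((polyIter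
            (X ^ p
              + C ((-(p : RatFunc k) * B ^ p - (p : RatFunc k) * B) /
                  ((p : RatFunc k) * B ^ (p - 1) + (p : RatFunc k) - 1)) * X ^ (p - 1)
              + C B) n).SplittingField) := by
  rw [Nat.cast_mul, Nat.cast_sub (by omega), Nat.cast_one] at hpk
  have hp0 : (p : k) ≠ 0 := left_ne_zero_of_mul hpk
  have hp1 : (p : k) - 1 ≠ 0 := right_ne_zero_of_mul hpk
  let f := algebraMap k (AlgebraicClosure k)
  have hp0' : (p : AlgebraicClosure k) ≠ 0 := by
    rw [← map_natCast f]; exact (map_ne_zero f).mpr hp0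
  have hp1' : (p : AlgebraicClosure k) - 1 ≠ 0 := by
    rw [← map_natCast f, ← map_one f, ← map_sub]; exact (map_ne_zero f).mpr hp1
  obtain ⟨N, hN1, hN⟩ := algclosed_case p hp hp3 hp0' hp1'
  obtain ⟨ι₁, hι₁⟩ := phiK_map_closure f p
  obtain ⟨ι, hfin, hι⟩ := exists_subst B hB
  obtain ⟨m, hm⟩ := splitting_le_mul ι hfin
  have hkey : ∀ n : ℕ, (Nat.factorial p) ^ (∑ i ∈ Finset.range n, p ^ i) ≤
      N * m * Module.finrank (RatFunc k) (polyIter ((phiK k p).map ι) n).SplittingField := by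
    intro n
    have h1 := splitting_map_le ι₁ (polyIter (phiK k p) n)
    rw [polyIter_map, hι₁] at h1
    have h2 := hm (polyIter (phiK k p) n)
    rw [polyIter_map] at h2
    rw [mul_assoc]
    exact (hN n).trans (Nat.mul_le_mul_left _ (h1.trans h2))
  rw [phiK_map_subst p B ι hι] at hkey
  refine ⟨N * m, ?_, fun n _ => hkey n⟩
  by_contra h
  have h0 : N * m = 0 := by omega
  have := hkey 0
  rw [h0] at this
  simp at this
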